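/- Let 0 ≤ r < 1, let U be a mild solution with U(t_n) ∈ H^{1+r}(𝕋) × H^r(𝕋), and set R₂(t_n) := ∫_{−τ}^{τ} e^{−sL} [ F(e^{sL} U(t_n)) − F(U(t_n)) ] ds. Then ||R₂(t_n)||₁ ≲ τ^{2+r} ( 1 + ||U(t_n)||_{1+r} )². -/

import Mathlib

open MeasureTheory Real Set

namespace KG

/-- Points of the `d`-dimensional torus `𝕋^d`, modeled by `ℝ^d` together with
`1`-periodic functions. -/
abbrev Pt (d : ℕ) := Fin d → ℝ

/-- Real-valued fields on the torus. -/
abbrev Fn (d : ℕ) := Pt d → ℝ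

/-- A pair `U = (u, ∂ₜ u)`. -/
abbrev Pair (d : ℕ) := Fn d × Fn d

/-- A fundamental domain of the torus. -/
def box (d : ℕ) : Set (Pt d) := Set.univ.pi fun _ => Set.Ico (0:ℝ) 1

/-- `1`-periodicity in each coordinate direction. -/
def Per {d : ℕ} (u : Fn d) : Prop := ∀ x i, u (x + Pi.single i 1) = u x

/-- The character `e^{2π i k·x}` of the torus. -/
noncomputable def ch {d : ℕ} (k : Fin d → ℤ) (x : Pt d) : ℂ :=
  Complex.exp (2 * (Real.pi : ℂ) * Complex.I * ∑ i, (k i : ℂ) * (x i : ℂ))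

/-- The `k`-th Fourier coefficient of `u`. -/
noncomputable def fc {d : ℕ} (u : Fn d) (k : Fin d → ℤ) : ℂ :=
  ∫ x in box d, (u x : ℂ) * ch (-k) x

/-- `|k|`. -/
noncomputable def freq {d : ℕ} (k : Fin d → ℤ) : ℝ := Real.sqrt (∑ i, ((k i : ℝ))^2)

/-- The bracket `⟨k⟩ = max(|k|, 1)`. -/
noncomputable def jb {d : ℕ} (k : Fin d → ℤ) : ℝ := max (freq k) 1

/-- The (inhomogeneous) Sobolev norm `‖u‖_{H^α(𝕋^d)}`, defined on the Fourier side. -/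
noncomputable def sob {d : ℕ} (α : ℝ) (u : Fn d) : ℝ :=
  Real.sqrt (∑' k : Fin d → ℤ, jb k ^ (2*α) * ‖fc u k‖^2)

/-- The homogeneous Sobolev norm `‖u‖_{Ḣ^α(𝕋^d)}`. -/
noncomputable def hsob {d : ℕ} (α : ℝ) (u : Fn d) : ℝ :=
  Real.sqrt (∑' k : Fin d → ℤ, freq k ^ (2*α) * ‖fc u k‖^2)

/-- Membership `u ∈ H^α(𝕋^d)`. -/
def MemSob {d : ℕ} (α : ℝ) (u : Fn d) : Prop :=
  Summable fun k : Fin d → ℤ => jb k ^ (2*α) * ‖fc u k‖^2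

/-- The norm `‖W‖_α = (‖w₁‖²_{H^α} + ‖w₂‖²_{H^{α-1}})^{1/2}` of a pair. -/
noncomputable def pnorm {d : ℕ} (α : ℝ) (U : Pair d) : ℝ :=
  Real.sqrt (sob α U.1 ^ 2 + sob (α-1) U.2 ^ 2)

/-- The energy-type norm `|W|_α = (‖w₁‖²_{Ḣ^α} + ‖w₂‖²_{H^{α-1}})^{1/2}` of a pair. -/
noncomputable def penorm {d : ℕ} (α : ℝ) (U : Pair d) : ℝ :=
  Real.sqrt (hsob α U.1 ^ 2 + sob (α-1) U.2 ^ 2)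

/-- Membership `W ∈ H^α(𝕋^d) × H^{α-1}(𝕋^d)`. -/
def PMem {d : ℕ} (α : ℝ) (U : Pair d) : Prop := MemSob α U.1 ∧ MemSob (α-1) U.2

/-- The frequency `ω_k = 2π|k|` of the wave operator on the `k`-th mode. -/
noncomputable def omg {d : ℕ} (k : Fin d → ℤ) : ℝ := 2 * Real.pi * freq k

/-- `sin(ωt)/ω`, extended by its limit `t` at `ω = 0`. -/
noncomputable def snc (ω t : ℝ) : ℝ := if ω = 0 then t else Real.sin (ω * t) / ω

/-- The group `e^{tL}`, `L = [[0,I],[Δ,0]]`, acting modewise by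
`[[cos(ω_k t), sin(ω_k t)/ω_k], [-ω_k sin(ω_k t), cos(ω_k t)]]`. -/
noncomputable def expL {d : ℕ} (t : ℝ) (U : Pair d) : Pair d :=
  (fun x => (∑' k : Fin d → ℤ,
      ((Real.cos (omg k * t) : ℂ) * fc U.1 k + ((snc (omg k) t : ℝ) : ℂ) * fc U.2 k)
        * ch k x).re,
   fun x => (∑' k : Fin d → ℤ,
      (((-(omg k) * Real.sin (omg k * t) : ℝ) : ℂ) * fc U.1 k
        + (Real.cos (omg k * t) : ℂ) * fc U.2 k) * ch k x).re)

/-- The nonlinearity `F(U) = (0, f(u))ᵀ`. -/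
def Fnl {d : ℕ} (f : ℝ → ℝ) (U : Pair d) : Pair d :=
  (fun _ => 0, fun x => f (U.1 x))

/-- `H(U) = (-f(u), f'(u) v)ᵀ`. -/
noncomputable def Hnl {d : ℕ} (f : ℝ → ℝ) (U : Pair d) : Pair d :=
  (fun x => -(f (U.1 x)), fun x => deriv f (U.1 x) * U.2 x)

/-- Componentwise (pointwise) integral of a `Pair`-valued map. -/
noncomputable def pInt {d : ℕ} (a b : ℝ) (G : ℝ → Pair d) : Pair d :=
  (fun x => ∫ s in a..b, (G s).1 x, fun x => ∫ s in a..b, (G s).2 x)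

/-- Mild (energy) solution: the variation-of-constants (Duhamel) formula. -/
def IsMild {d : ℕ} (f : ℝ → ℝ) (T : ℝ) (U : ℝ → Pair d) : Prop :=
  ∀ t s : ℝ, 0 ≤ t → 0 ≤ s → t + s ≤ T →
    U (t + s) = expL s (U t) + pInt 0 s fun σ => expL (s - σ) (Fnl f (U (t + σ)))

/-- `τ² e^{τL} φ₂(-2τL) W = ∫₀^τ (τ-s) e^{(τ-2s)L} W ds`, where
`φ₂(A) = A⁻²(e^A - A - I)`. -/
noncomputable def corrNeg {d : ℕ} (τ : ℝ) (W : Pair d) : Pair d :=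
  pInt 0 τ fun s => (τ - s) • expL (τ - 2*s) W

/-- `τ² e^{τL} φ₂(2τL) W = ∫₀^τ (τ-s) e^{(τ+2s)L} W ds`. -/
noncomputable def corrPos {d : ℕ} (τ : ℝ) (W : Pair d) : Pair d :=
  pInt 0 τ fun s => (τ - s) • expL (τ + 2*s) W

/-- The product norm `|||(V₁,V₂)|||_α = (‖V₁‖_α² + ‖V₂‖_α²)^{1/2}`. -/
noncomputable def tnorm {d : ℕ} (α : ℝ) (UU : Pair d × Pair d) : ℝ :=
  Real.sqrt (pnorm α UU.1 ^ 2 + pnorm α UU.2 ^ 2)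


/-- the character on the line -/
noncomputable def ee (n : ℤ) (y : ℝ) : ℂ :=
  Complex.exp (2 * (Real.pi : ℂ) * Complex.I * ((n : ℂ) * (y : ℂ)))

lemma ee_eq (n : ℤ) (y : ℝ) : ee n y = Complex.exp (((2 * π * (n * y) : ℝ) : ℂ) * Complex.I) := by
  unfold ee; congr 1; push_cast; ring

lemma ee_norm (n : ℤ) (y : ℝ) : ‖ee n y‖ = 1 := by
  rw [ee_eq, Complex.norm_exp_ofReal_mul_I]

lemma ee_add (n : ℤ) (x y : ℝ) : ee n (x + y) = ee n x * ee n y := by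
  unfold ee; rw [← Complex.exp_add]; congr 1; push_cast; ring

lemma ee_add_left (m n : ℤ) (y : ℝ) : ee m y * ee n y = ee (m + n) y := by
  unfold ee; rw [← Complex.exp_add]; congr 1; push_cast; ring

lemma ee_conj (n : ℤ) (y : ℝ) : (starRingEnd ℂ) (ee n y) = ee (-n) y := by
  unfold ee; rw [← Complex.exp_conj]; congr 1; simp [map_ofNat (starRingEnd ℂ) 2]

lemma ee_neg (n : ℤ) (y : ℝ) : ee (-n) y = ee n (-y) := by
  unfold ee; congr 1; push_cast; ring

lemma ee_one (n : ℤ) : ee n 1 = 1 := by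
  unfold ee
  rw [Complex.exp_eq_one_iff]
  exact ⟨n, by push_cast; ring⟩

lemma ee_zero (n : ℤ) : ee n 0 = 1 := by
  unfold ee; simp

lemma ee_per (n : ℤ) : Function.Periodic (ee n) 1 := by
  intro y; rw [ee_add, ee_one, mul_one]

lemma ee_cont (n : ℤ) : Continuous (ee n) := by
  unfold ee; fun_prop

lemma ee_diff (n : ℤ) (h : ℝ) : ‖ee n h - ee n (-h)‖ = 2 * |Real.sin (2 * π * |(n : ℝ)| * h)| := by
  have h1 : ee n h - ee n (-h) = 2 * ((Real.sin (2 * π * n * h) : ℝ) : ℂ) * Complex.I := by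
    rw [ee_eq, ee_eq, Complex.exp_mul_I, Complex.exp_mul_I]
    have : ((2 * π * (n * -h) : ℝ) : ℂ) = -((2 * π * (n * h) : ℝ) : ℂ) := by push_cast; ring
    rw [this, Complex.cos_neg, Complex.sin_neg]
    push_cast
    rw [show (2 * (π : ℂ) * n * h) = 2 * π * (n * h) by ring]
    ring
  rw [h1]
  simp only [norm_mul, Complex.norm_I, mul_one, Complex.norm_real, Real.norm_eq_abs]
  rcases abs_cases (n : ℝ) with ⟨h2, _⟩ | ⟨h2, _⟩
  · rw [h2]; simp
  · rw [h2, show 2 * π * -(n : ℝ) * h = -(2 * π * n * h) by ring, Real.sin_neg, abs_neg]; simp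

lemma ee_int (n : ℤ) : ∫ y in (0:ℝ)..1, ee n y = if n = 0 then 1 else 0 := by
  split_ifs with h
  · subst h; simp [ee]
  · have hc : (2 * (π : ℂ) * Complex.I * n) ≠ 0 := by
      simp [h, Real.pi_ne_zero]
    have h2 := integral_exp_mul_complex (a := 0) (b := 1) hc
    have h3 : ∀ y : ℝ, ee n y = Complex.exp (2 * (π : ℂ) * Complex.I * n * y) := by
      intro y; unfold ee; congr 1; ring
    rw [← h3, ← h3, ee_one, ee_zero] at h2
    simp only [h3]
    rw [h2]; simp

noncomputable def fh (φ : ℝ → ℝ) (n : ℤ) : ℂ := ∫ y in (0:ℝ)..1, (φ y : ℂ) * ee (-n) y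

lemma ch_eq (k : Fin 1 → ℤ) (y : ℝ) : ch k (fun _ => y) = ee (k 0) y := by
  simp [ch, ee]

lemma fc_eq (u : Fn 1) (k : Fin 1 → ℤ) : fc u k = fh (fun y => u fun _ => y) (k 0) := by
  unfold fc fh
  rw [intervalIntegral.integral_of_le zero_le_one, ← integral_Ico_eq_integral_Ioc]
  rw [← (volume_preserving_funUnique (Fin 1) ℝ).setIntegral_preimage_emb
    (MeasurableEquiv.funUnique (Fin 1) ℝ).measurableEmbedding]
  have hb : box 1 = (MeasurableEquiv.funUnique (Fin 1) ℝ) ⁻¹' Ico 0 1 := by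
    ext x; simp [box]
  rw [hb]
  congr 1
  ext x
  have hx : (fun _ : Fin 1 => (MeasurableEquiv.funUnique (Fin 1) ℝ) x) = x := by
    ext i; fin_cases i; simp
  have h2 := ch_eq (-k) ((MeasurableEquiv.funUnique (Fin 1) ℝ) x)
  rw [hx] at h2
  simp only [hx, h2]
  simp

lemma fh_eq (φ : ℝ → ℝ) (n : ℤ) :
    fh φ n = fourierCoeffOn (zero_lt_one (α := ℝ)) (fun y => (φ y : ℂ)) n := by
  rw [fourierCoeffOn_eq_integral]
  simp only [sub_zero, div_one, one_smul, fh]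
  congr 1
  ext y
  rw [fourier_coe_apply, smul_eq_mul, mul_comm]
  congr 1
  unfold ee; congr 1; push_cast; ring

lemma parseval {φ : ℝ → ℝ} (h : Continuous φ) :
    HasSum (fun n => ‖fh φ n‖ ^ 2) (∫ y in (0:ℝ)..1, φ y ^ 2) := by
  have hc : Continuous (fun y => (φ y : ℂ)) := Complex.continuous_ofReal.comp h
  have h1 : MemLp (fun y => (φ y : ℂ)) 2 (volume.restrict (Ioc (0:ℝ) 1)) := by
    have := (hc.memLp_of_hasCompactSupport (p := 2) (μ := volume.restrict (Ioc (0:ℝ) 1)))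
    obtain ⟨M, hM⟩ := (isCompact_Icc (a := (0:ℝ)) (b := 1)).exists_bound_of_continuousOn hc.continuousOn
    refine MemLp.of_bound hc.aestronglyMeasurable M ?_
    filter_upwards [ae_restrict_mem measurableSet_Ioc] with x hx
    exact hM x ⟨hx.1.le, hx.2⟩
  have h2 := hasSum_sq_fourierCoeffOn (zero_lt_one (α := ℝ)) h1
  simpa [fh_eq] using h2

lemma fh_conj (φ : ℝ → ℝ) (n : ℤ) : fh φ (-n) = (starRingEnd ℂ) (fh φ n) := by
  unfold fh
  rw [intervalIntegral.integral_of_le zero_le_one, intervalIntegral.integral_of_le zero_le_one,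
    ← integral_conj]
  congr 1; ext y
  simp [ee_conj]

lemma fh_ii {φ : ℝ → ℝ} (h : Continuous φ) (n : ℤ) :
    IntervalIntegrable (fun y => (φ y : ℂ) * ee (-n) y) volume 0 1 :=
  Continuous.intervalIntegrable ((Complex.continuous_ofReal.comp h).mul (ee_cont _)) _ _

lemma fh_sub {φ ψ : ℝ → ℝ} (h : Continuous φ) (h' : Continuous ψ) (n : ℤ) :
    fh (fun y => φ y - ψ y) n = fh φ n - fh ψ n := by
  unfold fh
  rw [← intervalIntegral.integral_sub (fh_ii h n) (fh_ii h' n)]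
  congr 1; ext y; push_cast; ring

lemma fh_add {φ ψ : ℝ → ℝ} (h : Continuous φ) (h' : Continuous ψ) (n : ℤ) :
    fh (fun y => φ y + ψ y) n = fh φ n + fh ψ n := by
  unfold fh
  rw [← intervalIntegral.integral_add (fh_ii h n) (fh_ii h' n)]
  congr 1; ext y; push_cast; ring

lemma fh_shift {φ : ℝ → ℝ} (hp : Function.Periodic φ 1) (h : ℝ) (n : ℤ) :
    fh (fun y => φ (y + h)) n = ee n h * fh φ n := by
  unfold fh
  have h1 : ∀ y : ℝ, (φ (y + h) : ℂ) * ee (-n) y = ee n h * ((φ (y + h) : ℂ) * ee (-n) (y + h)) := by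
    intro y
    have : ee n h * ee (-n) h = 1 := by rw [ee_add_left]; simp [ee]
    rw [ee_add]
    linear_combination (-(φ (y + h) : ℂ) * ee (-n) y) * this
  simp only [h1]
  rw [intervalIntegral.integral_const_mul]
  congr 1
  rw [intervalIntegral.integral_comp_add_right (fun y => (φ y : ℂ) * ee (-n) y)]
  have hper : Function.Periodic (fun y => (φ y : ℂ) * ee (-n) y) 1 := by
    intro y; simp only [hp y, ee_per (-n) y]
  have := hper.intervalIntegral_add_eq h 0
  rw [zero_add] at this ⊢
  rw [← this, add_comm]

/-- real Fourier series -/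
noncomputable def Sr (c : ℤ → ℂ) (y : ℝ) : ℝ := (∑' n, c n * ee n y).re

def Cj (c : ℤ → ℂ) : Prop := ∀ n, c (-n) = (starRingEnd ℂ) (c n)

lemma Sr_per (c : ℤ → ℂ) : Function.Periodic (Sr c) 1 := by
  intro y; unfold Sr; simp only [ee_per _ y]

lemma Sr_sum {c : ℤ → ℂ} (hc : Summable fun n => ‖c n‖) (y : ℝ) :
    Summable fun n => c n * ee n y := by
  refine Summable.of_norm ?_
  simpa [ee_norm] using hc

lemma Sr_cont {c : ℤ → ℂ} (hc : Summable fun n => ‖c n‖) : Continuous (Sr c) := by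
  refine Complex.continuous_re.comp ?_
  refine continuous_tsum (fun n => continuous_const.mul (ee_cont n)) hc ?_
  intro n x; simp [ee_norm]

lemma Sr_ofReal {c : ℤ → ℂ} (hj : Cj c) (y : ℝ) :
    ((Sr c y : ℝ) : ℂ) = ∑' n, c n * ee n y := by
  unfold Sr
  apply Complex.conj_eq_iff_re.mp
  rw [Complex.conj_tsum, ← (Equiv.neg ℤ).tsum_eq]
  congr 1; ext n
  simp [ee_conj, hj n]

lemma Sr_fh {c : ℤ → ℂ} (hc : Summable fun n => ‖c n‖) (hj : Cj c) (n : ℤ) :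
    fh (Sr c) n = c n := by
  unfold fh
  simp only [Sr_ofReal hj]
  let F : ℤ → C(ℝ, ℂ) := fun m => ⟨fun y => c m * ee m y * ee (-n) y,
    (continuous_const.mul (ee_cont m)).mul (ee_cont _)⟩
  have hs : Summable fun i => ‖ContinuousMap.restrict (↑(⟨Set.uIcc (0:ℝ) 1, isCompact_uIcc⟩ :
      TopologicalSpace.Compacts ℝ)) (F i)‖ := by
    refine Summable.of_nonneg_of_le (fun _ => norm_nonneg _) (fun i => ?_) hc
    rw [ContinuousMap.norm_le _ (norm_nonneg _)]
    intro x
    simp [F, ee_norm]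
  have h1 := (intervalIntegral.hasSum_intervalIntegral_of_summable_norm hs).tsum_eq
  have h2 : ∀ y : ℝ, (∑' m, c m * ee m y) * ee (-n) y = ∑' m, F m y := by
    intro y; rw [← tsum_mul_right]; rfl
  simp only [h2]
  rw [← h1]
  have h3 : ∀ m, ∫ y in (0:ℝ)..1, F m y = if m = n then c n else 0 := by
    intro m
    have : ∀ y, F m y = c m * ee (m + -n) y := by
      intro y; simp only [F, ContinuousMap.coe_mk]; rw [mul_assoc, ee_add_left]
    simp only [this]
    rw [intervalIntegral.integral_const_mul, ee_int]
    by_cases h : m = n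
    · subst h; simp
    · have : m + -n ≠ 0 := by omega
      simp [h, this]
  simp only [h3, tsum_ite_eq]

lemma Sr_sub {c d : ℤ → ℂ} (hc : Summable fun n => ‖c n‖) (hd : Summable fun n => ‖d n‖) (y : ℝ) :
    Sr c y - Sr d y = Sr (fun n => c n - d n) y := by
  unfold Sr
  rw [← Complex.sub_re, ← (Sr_sum hc y).tsum_sub (Sr_sum hd y)]
  simp only [sub_mul]

lemma Sr_shift (c : ℤ → ℂ) (y h : ℝ) : Sr c (y + h) = Sr (fun n => c n * ee n h) y := by
  unfold Sr
  congr 2; ext n; rw [ee_add]; ring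

lemma Sr_bound {c : ℤ → ℂ} (hc : Summable fun n => ‖c n‖) (y : ℝ) : |Sr c y| ≤ ∑' n, ‖c n‖ := by
  unfold Sr
  refine (Complex.abs_re_le_norm _).trans ?_
  have := norm_tsum_le_tsum_norm (f := fun n => c n * ee n y) (by simpa [ee_norm] using hc)
  simpa [ee_norm] using this

lemma Sr_L2 {c : ℤ → ℂ} (hc : Summable fun n => ‖c n‖) (hj : Cj c) :
    HasSum (fun n => ‖c n‖ ^ 2) (∫ y in (0:ℝ)..1, Sr c y ^ 2) := by
  have := parseval (Sr_cont hc)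
  simpa [Sr_fh hc hj] using this

lemma lip {f : ℝ → ℝ} {L : ℝ} (hf : Differentiable ℝ f)
    (hf1 : ∀ x : ℝ, |deriv f x| ≤ L) (x y : ℝ) : |f x - f y| ≤ L * |x - y| := by
  have := convex_univ.norm_image_sub_le_of_norm_deriv_le (f := f) (C := L) (𝕜 := ℝ)
    (fun x _ => hf x) (fun x _ => hf1 x) (mem_univ y) (mem_univ x)
  simpa using this

lemma fourpt {f : ℝ → ℝ} {L : ℝ} (hf : ContDiff ℝ 2 f)
    (hf1 : ∀ x : ℝ, |deriv f x| ≤ L) (hf2 : ∀ x : ℝ, |deriv (deriv f) x| ≤ L) (A B C D : ℝ) :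
    |f A - f B - f C + f D| ≤ L * |A - B - C + D| + L * |C - D| * |B - D| := by
  have hd : Differentiable ℝ f := hf.differentiable (by norm_num)
  have hd2 : Differentiable ℝ (deriv f) := by
    have : ContDiff ℝ (1 + 1) f := by simpa [one_add_one_eq_two] using hf
    exact (contDiff_succ_iff_deriv.mp this).2.2.differentiable (by norm_num)
  have hg : ∀ x, HasDerivAt (fun x => f (x + (C - D)) - f x) (deriv f (x + (C - D)) - deriv f x) x := by
    intro x
    exact ((hd _).hasDerivAt.comp_add_const x (C - D)).sub (hd x).hasDerivAt
  have h1 := lip (f := fun x => f (x + (C - D)) - f x) (L := L * |C - D|)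
    (fun x => (hg x).differentiableAt) (fun x => by
      rw [(hg x).deriv]
      simpa using lip hd2 hf2 (x + (C - D)) x) B D
  have h2 := lip hd hf1 A (B + (C - D))
  simp only [add_sub_cancel] at h1
  have e1 : f A - f B - f C + f D = (f A - f (B + (C - D))) + (f (B + (C - D)) - f B - (f C - f D)) := by ring
  have e2 : A - B - C + D = A - (B + (C - D)) := by ring
  rw [e1, e2]
  exact (abs_add_le _ _).trans (add_le_add h2 h1)

/-- the basic L2 bound -/
lemma lemB {G : ℝ → ℝ} (hG : Continuous G) {p q : ℤ → ℂ} {E : ℤ → ℝ} {L κ α β : ℝ}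
    (hE : Summable fun n => E n ^ 2)
    (hp : Summable fun n => ‖p n‖) (hq : Summable fun n => ‖q n‖) (hpj : Cj p) (hqj : Cj q)
    (hpa : ∀ n, ‖p n‖ ≤ α * E n) (hqb : ∀ n, ‖q n‖ ≤ β * E n)
    (hb : ∀ y, |G y| ≤ L * |Sr p y| + κ * |Sr q y|) (S : Finset ℤ) :
    ∑ n ∈ S, ‖fh G n‖ ^ 2 ≤ 2 * (L ^ 2 * α ^ 2 + κ ^ 2 * β ^ 2) * ∑' n, E n ^ 2 := by
  have key : ∀ {p : ℤ → ℂ} {α : ℝ}, (Summable fun n => ‖p n‖) → Cj p → (∀ n, ‖p n‖ ≤ α * E n) →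
      ∫ y in (0:ℝ)..1, Sr p y ^ 2 ≤ α ^ 2 * ∑' n, E n ^ 2 := by
    intro p α hp hpj hpa
    rw [← tsum_mul_left, ← (Sr_L2 hp hpj).tsum_eq]
    refine (Sr_L2 hp hpj).summable.tsum_le_tsum (fun n => ?_) (hE.mul_left _)
    rw [← mul_pow]
    exact pow_le_pow_left₀ (norm_nonneg _) (hpa n) 2
  have h1 := key hp hpj hpa
  have h2 := key hq hqj hqb
  have hPG := parseval hG
  refine (hPG.summable.sum_le_tsum S (fun _ _ => by positivity)).trans ?_
  rw [hPG.tsum_eq]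
  have ci1 : Continuous fun y => Sr p y ^ 2 := (Sr_cont hp).pow 2
  have ci2 : Continuous fun y => Sr q y ^ 2 := (Sr_cont hq).pow 2
  have h3 : ∫ y in (0:ℝ)..1, G y ^ 2 ≤
      ∫ y in (0:ℝ)..1, (2 * L ^ 2 * Sr p y ^ 2 + 2 * κ ^ 2 * Sr q y ^ 2) := by
    refine intervalIntegral.integral_mono_on zero_le_one ((hG.pow 2).intervalIntegrable _ _)
      (Continuous.intervalIntegrable (by fun_prop) _ _) (fun y _ => ?_)
    have h4 := hb y
    have h5 : G y ^ 2 ≤ (L * |Sr p y| + κ * |Sr q y|) ^ 2 := by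
      rw [← sq_abs (G y)]
      exact pow_le_pow_left₀ (abs_nonneg _) h4 2
    rw [← sq_abs (Sr p y), ← sq_abs (Sr q y)]
    nlinarith [sq_nonneg (L * |Sr p y| - κ * |Sr q y|)]
  rw [intervalIntegral.integral_add (Continuous.intervalIntegrable (by fun_prop) _ _)
    (Continuous.intervalIntegrable (by fun_prop) _ _), intervalIntegral.integral_const_mul,
    intervalIntegral.integral_const_mul] at h3
  nlinarith [mul_le_mul_of_nonneg_left h1 (by positivity : 0 ≤ 2 * L ^ 2),
    mul_le_mul_of_nonneg_left h2 (by positivity : 0 ≤ 2 * κ ^ 2)]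

set_option linter.unusedVariables false

noncomputable def jj (n : ℤ) : ℝ := max |(n : ℝ)| 1
noncomputable def ww (n : ℤ) : ℝ := 2 * π * |(n : ℝ)|

lemma jj_one (n : ℤ) : 1 ≤ jj n := le_max_right _ _
lemma jj_pos (n : ℤ) : 0 < jj n := lt_of_lt_of_le one_pos (jj_one n)
lemma ww_nonneg (n : ℤ) : 0 ≤ ww n := by unfold ww; positivity
lemma ww_le (n : ℤ) : ww n ≤ 7 * jj n := by
  unfold ww
  have h1 : |(n : ℝ)| ≤ jj n := le_max_left _ _
  have h2 := Real.pi_lt_d2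
  have h3 : 0 ≤ |(n : ℝ)| := abs_nonneg _
  nlinarith
lemma ww_neg (n : ℤ) : ww (-n) = ww n := by unfold ww; simp
lemma jj_neg (n : ℤ) : jj (-n) = jj n := by unfold jj; simp
lemma jj_of_ne {n : ℤ} (h : n ≠ 0) : jj n = |(n : ℝ)| := by
  unfold jj
  apply max_eq_left
  have : 1 ≤ |n| := Int.one_le_abs h
  exact_mod_cast this
lemma ww_zero : ww 0 = 0 := by simp [ww]
lemma jj_le_ww {n : ℤ} (h : n ≠ 0) : jj n ≤ ww n := by
  rw [jj_of_ne h]; unfold ww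
  have h3 : 0 ≤ |(n : ℝ)| := abs_nonneg _
  nlinarith [Real.pi_gt_three]
lemma ww_ne {n : ℤ} (h : n ≠ 0) : ww n ≠ 0 := (lt_of_lt_of_le (jj_pos n) (jj_le_ww h)).ne'

lemma jj_summable : Summable fun n : ℤ => ((jj n)⁻¹) ^ 2 := by
  have h := (Real.summable_one_div_int_pow (p := 2)).mpr (by norm_num)
  have h2 : Summable fun n : ℤ => if n = 0 then (1:ℝ) else 0 := (hasSum_ite_eq 0 1).summable
  refine Summable.of_nonneg_of_le (fun n => by positivity) (fun n => ?_) (h.add h2)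
  by_cases hn : n = 0
  · subst hn; simp [jj]
  · simp [jj_of_ne hn, hn]

lemma x_le_rpow {x T r : ℝ} (hx : 0 ≤ x) (hxT : x ≤ T) (hr0 : 0 ≤ r) (hr1 : r ≤ 1) :
    x ≤ (1 + T) * x ^ r := by
  rcases le_total x 1 with h | h
  · have h1 : x ^ (1:ℝ) ≤ x ^ r := Real.rpow_le_rpow_of_exponent_ge_of_imp hx h hr1 (fun _ h2 => absurd h2 one_ne_zero)
    rw [Real.rpow_one] at h1
    nlinarith [Real.rpow_nonneg hx r]
  · have h1 : 1 ≤ x ^ r := Real.one_le_rpow h hr0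
    nlinarith

lemma rpow_le_K {x T r : ℝ} (hx : 0 ≤ x) (hxT : x ≤ T) (hr0 : 0 ≤ r) (hr1 : r ≤ 1) :
    x ^ r ≤ 1 + T := by
  have h1 : x ^ r ≤ (1 + x) ^ r := Real.rpow_le_rpow hx (by linarith) hr0
  have h2 : (1 + x) ^ r ≤ (1 + x) ^ (1:ℝ) := Real.rpow_le_rpow_of_exponent_le (by linarith) hr1
  rw [Real.rpow_one] at h2
  linarith

lemma small_rpow {x ρ σ : ℝ} (hx : 0 ≤ x) (h : x ≤ 1) (hr1 : ρ ≤ σ) (hσ : 0 < σ) : x ^ σ ≤ x ^ ρ := by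
  rcases hx.eq_or_lt with h0 | h0
  · subst h0; rw [Real.zero_rpow hσ.ne']; exact Real.rpow_nonneg le_rfl _
  · exact Real.rpow_le_rpow_of_exponent_ge h0 h hr1

lemma sin_rpow {x r : ℝ} (hr0 : 0 ≤ r) (hr1 : r ≤ 1) : |Real.sin x| ≤ |x| ^ r := by
  rcases le_total |x| 1 with h | h
  · have := small_rpow (abs_nonneg x) h hr1 one_pos
    rw [Real.rpow_one] at this
    exact (Real.abs_sin_le_abs).trans this
  · exact (Real.abs_sin_le_one x).trans (Real.one_le_rpow h hr0)

lemma cos_rpow {x r : ℝ} (hr0 : 0 ≤ r) (hr1 : r ≤ 2) : |Real.cos x - 1| ≤ 2 * |x| ^ r := by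
  have hc := Real.cos_le_one x
  rw [abs_of_nonpos (by linarith)]
  rcases le_total |x| 1 with h | h
  · have := small_rpow (abs_nonneg x) h hr1 two_pos
    rw [Real.rpow_two, sq_abs] at this
    have := Real.one_sub_sq_div_two_le_cos (x := x)
    nlinarith [sq_nonneg x]
  · have := Real.one_le_rpow h hr0
    have := Real.neg_one_le_cos x
    linarith

lemma ws_rpow (n : ℤ) (s : ℝ) {ρ : ℝ} (h0 : 0 ≤ ρ) (h2 : ρ ≤ 2) :
    |ww n * s| ^ ρ ≤ 49 * (jj n ^ ρ * |s| ^ ρ) := by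
  rw [abs_mul, abs_of_nonneg (ww_nonneg n)]
  have h3 : (ww n * |s|) ^ ρ ≤ (7 * (jj n * |s|)) ^ ρ := by
    apply Real.rpow_le_rpow (mul_nonneg (ww_nonneg n) (abs_nonneg _)) _ h0
    nlinarith [ww_le n, abs_nonneg s]
  rw [Real.mul_rpow (by norm_num) (mul_nonneg (jj_pos n).le (abs_nonneg s)),
    Real.mul_rpow (jj_pos n).le (abs_nonneg s)] at h3
  have h4 : (7:ℝ) ^ ρ ≤ 7 ^ (2:ℝ) := Real.rpow_le_rpow_of_exponent_le (by norm_num) h2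
  have h5 : (7:ℝ) ^ (2:ℝ) = 49 := by norm_num
  have h6 : 0 ≤ jj n ^ ρ * |s| ^ ρ :=
    mul_nonneg (Real.rpow_nonneg (jj_pos n).le _) (Real.rpow_nonneg (abs_nonneg s) _)
  rw [h5] at h4
  nlinarith

lemma cos_m (n : ℤ) (s : ℝ) {ρ : ℝ} (h0 : 0 ≤ ρ) (h2 : ρ ≤ 2) :
    |Real.cos (ww n * s) - 1| ≤ 98 * (jj n ^ ρ * |s| ^ ρ) := by
  have := cos_rpow (x := ww n * s) h0 h2
  have := ws_rpow n s h0 h2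
  linarith

lemma sin_m (n : ℤ) (s : ℝ) : |Real.sin (ww n * s)| ≤ 7 * (jj n * |s|) := by
  refine Real.abs_sin_le_abs.trans ?_
  rw [abs_mul, abs_of_nonneg (ww_nonneg n)]
  nlinarith [ww_le n, abs_nonneg s]

lemma snc_le (n : ℤ) (s : ℝ) : |snc (ww n) s| ≤ |s| := by
  unfold snc
  split_ifs with h
  · rfl
  · have hp : 0 < ww n := lt_of_le_of_ne (ww_nonneg n) (Ne.symm h)
    rw [abs_div, abs_of_pos hp, div_le_iff₀ hp]
    refine Real.abs_sin_le_abs.trans ?_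
    rw [abs_mul, abs_of_pos hp, mul_comm]

lemma snc_m (n : ℤ) {s T r : ℝ} (hs : |s| ≤ T) (hr0 : 0 ≤ r) (hr1 : r ≤ 1) :
    |snc (ww n) s| ≤ (1 + T) * (|s| ^ r * (jj n ^ r * (jj n)⁻¹)) := by
  have hT : 0 ≤ T := (abs_nonneg s).trans hs
  by_cases hn : n = 0
  · subst hn
    have : jj 0 = 1 := by simp [jj]
    simp only [snc, ww_zero, if_true, this, Real.one_rpow, inv_one, mul_one]
    exact x_le_rpow (abs_nonneg s) hs hr0 hr1
  · have hw := ww_ne hn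
    have hp : 0 < ww n := lt_of_le_of_ne (ww_nonneg n) (Ne.symm hw)
    have hj := jj_le_ww hn
    have hj0 := jj_pos n
    simp only [snc, hw, if_false]
    rw [abs_div, abs_of_pos hp]
    have h1 : |Real.sin (ww n * s)| / ww n ≤ |s| ^ r * (ww n ^ r * (ww n)⁻¹) := by
      rw [div_eq_mul_inv]
      have h2 := sin_rpow (x := ww n * s) hr0 hr1
      rw [abs_mul, abs_of_pos hp, Real.mul_rpow hp.le (abs_nonneg s)] at h2
      calc _ ≤ (ww n ^ r * |s| ^ r) * (ww n)⁻¹ := by gcongr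
        _ = _ := by ring
    have h3 : ww n ^ r * (ww n)⁻¹ ≤ jj n ^ r * (jj n)⁻¹ := by
      rw [← Real.rpow_neg_one, ← Real.rpow_neg_one, ← Real.rpow_add hp, ← Real.rpow_add hj0]
      exact Real.rpow_le_rpow_of_nonpos hj0 hj (by linarith)
    have h4 : 0 ≤ |s| ^ r := Real.rpow_nonneg (abs_nonneg s) _
    have h5 : 0 ≤ jj n ^ r * (jj n)⁻¹ := by positivity
    calc _ ≤ _ := h1
      _ ≤ |s| ^ r * (jj n ^ r * (jj n)⁻¹) := by gcongr
      _ ≤ _ := by nlinarith [mul_nonneg h4 h5]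

/-- coefficients of `u_s` -/
noncomputable def uc (a b : ℤ → ℂ) (s : ℝ) (n : ℤ) : ℂ :=
  ((Real.cos (ww n * s) : ℝ) : ℂ) * a n + ((snc (ww n) s : ℝ) : ℂ) * b n

/-- coefficients of `u_s - u_0` -/
noncomputable def dc (a b : ℤ → ℂ) (s : ℝ) (n : ℤ) : ℂ :=
  ((Real.cos (ww n * s) - 1 : ℝ) : ℂ) * a n + ((snc (ww n) s : ℝ) : ℂ) * b n

noncomputable def EE (r : ℝ) (a b : ℤ → ℂ) (n : ℤ) : ℝ := jj n ^ (1 + r) * ‖a n‖ + jj n ^ r * ‖b n‖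

lemma EE_nonneg (r : ℝ) (a b : ℤ → ℂ) (n : ℤ) : 0 ≤ EE r a b n := by
  have := jj_pos n
  unfold EE; positivity

lemma dc_norm {r T : ℝ} (hr0 : 0 ≤ r) (hr1 : r ≤ 1) (a b : ℤ → ℂ) {s : ℝ} (hs : |s| ≤ T)
    (n : ℤ) : ‖dc a b s n‖ ≤ |Real.cos (ww n * s) - 1| * ‖a n‖ + |snc (ww n) s| * ‖b n‖ := by
  unfold dc
  refine (norm_add_le _ _).trans ?_
  rw [norm_mul, norm_mul, Complex.norm_real, Complex.norm_real, Real.norm_eq_abs, Real.norm_eq_abs]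

lemma dc1 {r T : ℝ} (hr0 : 0 ≤ r) (hr1 : r ≤ 1) (a b : ℤ → ℂ) {s : ℝ} (hs : |s| ≤ T)
    (n : ℤ) : ‖dc a b s n‖ ≤ (98 * (1 + T) * |s| ^ r) * ((jj n)⁻¹ * EE r a b n) := by
  refine (dc_norm hr0 hr1 a b hs n).trans ?_
  have hT : 0 ≤ T := (abs_nonneg s).trans hs
  have h1 := cos_m n s hr0 (by linarith)
  have h2 := snc_m n hs hr0 hr1
  have hj := jj_pos n
  have hjr : 0 ≤ jj n ^ r := by positivity
  have hsr : 0 ≤ |s| ^ r := by positivity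
  have e : (jj n)⁻¹ * jj n ^ (1 + r) = jj n ^ r := by
    rw [Real.rpow_add hj, Real.rpow_one]; field_simp
  unfold EE
  rw [mul_add (jj n)⁻¹, ← mul_assoc, ← mul_assoc, e, mul_add]
  apply add_le_add
  · rw [← mul_assoc]
    gcongr
    nlinarith [mul_nonneg hjr hsr, mul_nonneg (mul_nonneg hjr hsr) hT]
  · rw [← mul_assoc]
    gcongr
    refine h2.trans ?_
    have : 0 ≤ (1 + T) * (|s| ^ r * (jj n ^ r * (jj n)⁻¹)) := by positivity
    nlinarith

lemma a_le {r T : ℝ} (hr0 : 0 ≤ r) (hr1 : r ≤ 1) (a b : ℤ → ℂ) {s : ℝ} (hs : |s| ≤ T)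
    (n : ℤ) : jj n * ‖a n‖ + ‖b n‖ ≤ EE r a b n := by
  unfold EE
  have hj := jj_pos n
  have h1 : 1 ≤ jj n ^ r := Real.one_le_rpow (jj_one n) hr0
  rw [Real.rpow_add hj, Real.rpow_one]
  have : 0 ≤ jj n * ‖a n‖ := by positivity
  nlinarith [norm_nonneg (b n)]

lemma dc2 {r T : ℝ} (hr0 : 0 ≤ r) (hr1 : r ≤ 1) (a b : ℤ → ℂ) {s : ℝ} (hs : |s| ≤ T)
    (n : ℤ) : ‖dc a b s n‖ ≤ (98 * |s|) * EE r a b n := by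
  refine (dc_norm hr0 hr1 a b hs n).trans ?_
  have h1 := cos_m n s zero_le_one (by norm_num)
  rw [Real.rpow_one, Real.rpow_one] at h1
  have h2 := snc_le n s
  have h3 := a_le hr0 hr1 a b hs n
  calc _ ≤ 98 * (jj n * |s|) * ‖a n‖ + |s| * ‖b n‖ := by gcongr
    _ ≤ (98 * |s|) * (jj n * ‖a n‖ + ‖b n‖) := by
      nlinarith [mul_nonneg (abs_nonneg s) (norm_nonneg (b n))]
    _ ≤ _ := by gcongr

lemma dc4 {r T : ℝ} (hr0 : 0 ≤ r) (hr1 : r ≤ 1) (a b : ℤ → ℂ) {s : ℝ} (hs : |s| ≤ T)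
    (n : ℤ) : |Real.cos (ww n * s) - 1| * ‖a n‖ ≤ (98 * |s| ^ (1 + r)) * EE r a b n := by
  have h1 := cos_m n s (ρ := 1 + r) (by linarith) (by linarith)
  have hj := jj_pos n
  have h3 : jj n ^ (1 + r) * ‖a n‖ ≤ EE r a b n := by
    unfold EE
    have : 0 ≤ jj n ^ r * ‖b n‖ := by positivity
    linarith
  calc _ ≤ 98 * (jj n ^ (1 + r) * |s| ^ (1 + r)) * ‖a n‖ := by gcongr
    _ = (98 * |s| ^ (1 + r)) * (jj n ^ (1 + r) * ‖a n‖) := by ring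
    _ ≤ _ := by gcongr

lemma dc3 {r T : ℝ} (hr0 : 0 ≤ r) (hr1 : r ≤ 1) (a b : ℤ → ℂ) {s : ℝ} (hs : |s| ≤ T)
    (n : ℤ) : |Real.sin (ww n * s)| * ‖dc a b s n‖ ≤ (98 * (1 + T) * |s| ^ (1 + r)) * EE r a b n := by
  have hT : 0 ≤ T := (abs_nonneg s).trans hs
  have h1 := cos_m n s (ρ := 1 + r) (by linarith) (by linarith)
  have hj := jj_pos n
  have h2 := snc_m n hs hr0 hr1
  have h3 := sin_m n s
  have hA : |Real.sin (ww n * s)| * |Real.cos (ww n * s) - 1| ≤ 98 * (jj n ^ (1 + r) * |s| ^ (1 + r)) := by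
    have := Real.abs_sin_le_one (ww n * s)
    calc _ ≤ 1 * |Real.cos (ww n * s) - 1| := by gcongr
      _ ≤ _ := by rw [one_mul]; exact h1
  have hss : |s| ^ (1 + r) = |s| * |s| ^ r := by
    rcases (abs_nonneg s).eq_or_lt with h | h
    · rw [← h, Real.zero_rpow (by linarith), zero_mul]
    · rw [Real.rpow_add h, Real.rpow_one]
  have hB : |Real.sin (ww n * s)| * |snc (ww n) s| ≤ 7 * (1 + T) * (jj n ^ r * |s| ^ (1 + r)) := by
    calc _ ≤ (7 * (jj n * |s|)) * ((1 + T) * (|s| ^ r * (jj n ^ r * (jj n)⁻¹))) := by gcongr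
      _ = _ := by rw [hss]; field_simp
  have h0 := dc_norm hr0 hr1 a b hs n
  calc _ ≤ |Real.sin (ww n * s)| * (|Real.cos (ww n * s) - 1| * ‖a n‖ + |snc (ww n) s| * ‖b n‖) := by gcongr
    _ = (|Real.sin (ww n * s)| * |Real.cos (ww n * s) - 1|) * ‖a n‖ +
        (|Real.sin (ww n * s)| * |snc (ww n) s|) * ‖b n‖ := by ring
    _ ≤ (98 * (jj n ^ (1 + r) * |s| ^ (1 + r))) * ‖a n‖ +
        (7 * (1 + T) * (jj n ^ r * |s| ^ (1 + r))) * ‖b n‖ := by gcongr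
    _ ≤ _ := by
      unfold EE
      have q1 : 0 ≤ jj n ^ (1 + r) * |s| ^ (1 + r) * ‖a n‖ := by positivity
      have q2 : 0 ≤ jj n ^ r * |s| ^ (1 + r) * ‖b n‖ := by positivity
      nlinarith [mul_nonneg hT q1, mul_nonneg hT q2]

lemma dc5 {r T : ℝ} (hr0 : 0 ≤ r) (hr1 : r ≤ 1) (a b : ℤ → ℂ) {s : ℝ} (hs : |s| ≤ T)
    (h : ℝ) (n : ℤ) : |Real.sin (ww n * h)| * ‖a n‖ ≤ (7 * |h|) * EE r a b n := by
  have h3 := sin_m n h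
  have h4 := a_le hr0 hr1 a b hs n
  calc _ ≤ (7 * (jj n * |h|)) * ‖a n‖ := by gcongr
    _ = (7 * |h|) * (jj n * ‖a n‖) := by ring
    _ ≤ (7 * |h|) * EE r a b n := by
      gcongr
      linarith [norm_nonneg (b n)]

lemma uc1 {r T : ℝ} (hr0 : 0 ≤ r) (hr1 : r ≤ 1) (a b : ℤ → ℂ) {s : ℝ} (hs : |s| ≤ T)
    (n : ℤ) : ‖uc a b s n‖ ≤ ((1 + T) ^ 2) * ((jj n)⁻¹ * EE r a b n) := by
  have hT : 0 ≤ T := (abs_nonneg s).trans hs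
  have h2 := snc_m n hs hr0 hr1
  have hj := jj_pos n
  have hK := rpow_le_K (abs_nonneg s) hs hr0 hr1
  have e : (jj n)⁻¹ * jj n ^ (1 + r) = jj n ^ r := by
    rw [Real.rpow_add hj, Real.rpow_one]; field_simp
  have h1 : 1 ≤ jj n ^ r := Real.one_le_rpow (jj_one n) hr0
  have h3 : |snc (ww n) s| ≤ (1 + T) * ((1 + T) * (jj n ^ r * (jj n)⁻¹)) := by
    refine h2.trans ?_; gcongr
  have h0 : ‖uc a b s n‖ ≤ |Real.cos (ww n * s)| * ‖a n‖ + |snc (ww n) s| * ‖b n‖ := by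
    unfold uc
    refine (norm_add_le _ _).trans ?_
    rw [norm_mul, norm_mul, Complex.norm_real, Complex.norm_real, Real.norm_eq_abs, Real.norm_eq_abs]
  unfold EE
  rw [mul_add (jj n)⁻¹, ← mul_assoc, ← mul_assoc, e, mul_add]
  refine h0.trans (add_le_add ?_ ?_)
  · rw [← mul_assoc]
    gcongr
    refine (Real.abs_cos_le_one _).trans ?_
    nlinarith
  · rw [← mul_assoc]
    gcongr
    refine h3.trans (le_of_eq (by ring))

lemma uc2 {r T : ℝ} (hr0 : 0 ≤ r) (hr1 : r ≤ 1) (a b : ℤ → ℂ) {s : ℝ} (hs : |s| ≤ T)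
    (h : ℝ) (n : ℤ) : |Real.sin (ww n * h)| * ‖uc a b s n‖ ≤ (7 * (1 + T) ^ 2 * |h|) * EE r a b n := by
  have hT : 0 ≤ T := (abs_nonneg s).trans hs
  have h1 := sin_m n h
  have h2 := uc1 hr0 hr1 a b hs n
  have hj := jj_pos n
  have hE := EE_nonneg r a b n
  calc _ ≤ (7 * (jj n * |h|)) * (((1 + T) ^ 2) * ((jj n)⁻¹ * EE r a b n)) := by gcongr
    _ = _ := by field_simp

lemma jE_bound {E : ℤ → ℝ} (hE0 : ∀ n, 0 ≤ E n) (hE : Summable fun n => E n ^ 2) (S : Finset ℤ) :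
    ∑ n ∈ S, (jj n)⁻¹ * E n ≤ Real.sqrt ((∑' n : ℤ, ((jj n)⁻¹) ^ 2) * ∑' n, E n ^ 2) := by
  apply Real.le_sqrt_of_sq_le
  refine (Finset.sum_mul_sq_le_sq_mul_sq S _ _).trans ?_
  refine mul_le_mul (jj_summable.sum_le_tsum S (fun _ _ => by positivity))
    (hE.sum_le_tsum S (fun _ _ => by positivity)) (Finset.sum_nonneg fun _ _ => by positivity)
    (tsum_nonneg fun n => by positivity)

lemma jE_summable {E : ℤ → ℝ} (hE0 : ∀ n, 0 ≤ E n) (hE : Summable fun n => E n ^ 2) :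
    Summable fun n => (jj n)⁻¹ * E n :=
  summable_of_sum_le (fun n => mul_nonneg (inv_nonneg.mpr (jj_pos n).le) (hE0 n)) (jE_bound hE0 hE)

lemma jE_tsum {E : ℤ → ℝ} (hE0 : ∀ n, 0 ≤ E n) (hE : Summable fun n => E n ^ 2) :
    ∑' n, (jj n)⁻¹ * E n ≤ Real.sqrt ((∑' n : ℤ, ((jj n)⁻¹) ^ 2) * ∑' n, E n ^ 2) :=
  Real.tsum_le_of_sum_le (fun n => mul_nonneg (inv_nonneg.mpr (jj_pos n).le) (hE0 n)) (jE_bound hE0 hE)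


structure Dat (f : ℝ → ℝ) (L r T : ℝ) (a b : ℤ → ℂ) : Prop where
  hf : ContDiff ℝ 2 f
  hf1 : ∀ x : ℝ, |deriv f x| ≤ L
  hf2 : ∀ x : ℝ, |deriv (deriv f) x| ≤ L
  hr0 : 0 ≤ r
  hr1 : r ≤ 1
  ja : Cj a
  jb : Cj b
  hE : Summable fun n => EE r a b n ^ 2

noncomputable def uu (a b : ℤ → ℂ) (s : ℝ) : ℝ → ℝ := Sr (uc a b s)
noncomputable def gg (f : ℝ → ℝ) (a b : ℤ → ℂ) (s : ℝ) (y : ℝ) : ℝ := f (uu a b s y) - f (uu a b 0 y)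
noncomputable def QQ (r : ℝ) (a b : ℤ → ℂ) : ℝ := ∑' n, EE r a b n ^ 2
noncomputable def ZZ : ℝ := ∑' n : ℤ, ((jj n)⁻¹) ^ 2

lemma ZZ_nonneg : 0 ≤ ZZ := tsum_nonneg fun n => by positivity
lemma QQ_nonneg (r : ℝ) (a b : ℤ → ℂ) : 0 ≤ QQ r a b := tsum_nonneg fun n => by positivity

lemma snc_zero (w : ℝ) : snc w 0 = 0 := by simp [snc]
lemma snc_neg (w t : ℝ) : snc w (-t) = - snc w t := by
  unfold snc; split_ifs <;> simp [neg_div]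
lemma snc_cont (w : ℝ) : Continuous (snc w) := by
  unfold snc; split_ifs <;> fun_prop

lemma uc_zero (a b : ℤ → ℂ) : uc a b 0 = a := by
  ext n; simp [uc, snc_zero]

namespace Dat
variable {f : ℝ → ℝ} {L r T : ℝ} {a b : ℤ → ℂ}

lemma L0 (H : Dat f L r T a b) : 0 ≤ L := (abs_nonneg _).trans (H.hf1 0)

lemma jE (H : Dat f L r T a b) : Summable fun n => (jj n)⁻¹ * EE r a b n :=
  jE_summable (EE_nonneg r a b) H.hE

lemma uS (H : Dat f L r T a b) (s : ℝ) : Summable fun n => ‖uc a b s n‖ :=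
  Summable.of_nonneg_of_le (fun _ => norm_nonneg _) (uc1 H.hr0 H.hr1 a b (le_refl |s|)) (H.jE.mul_left _)

lemma dS (H : Dat f L r T a b) (s : ℝ) : Summable fun n => ‖dc a b s n‖ :=
  Summable.of_nonneg_of_le (fun _ => norm_nonneg _) (dc1 H.hr0 H.hr1 a b (le_refl |s|)) (H.jE.mul_left _)

lemma aS (H : Dat f L r T a b) : Summable fun n => ‖a n‖ := by
  have := H.uS 0
  rwa [uc_zero] at this

lemma uJ (H : Dat f L r T a b) (s : ℝ) : Cj (uc a b s) := by
  intro n; simp [uc, ww_neg, H.ja n, H.jb n, -Complex.ofReal_cos]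

lemma dJ (H : Dat f L r T a b) (s : ℝ) : Cj (dc a b s) := by
  intro n; simp only [dc, ww_neg, H.ja n, H.jb n, map_add, map_mul, Complex.conj_ofReal]

lemma u_sub (H : Dat f L r T a b) (s y : ℝ) : uu a b s y - uu a b 0 y = Sr (dc a b s) y := by
  unfold uu
  rw [Sr_sub (H.uS s) (H.uS 0), uc_zero]
  congr 1; ext n; simp only [uc, dc]; push_cast; ring

lemma u_cont (H : Dat f L r T a b) (s : ℝ) : Continuous (uu a b s) := Sr_cont (H.uS s)
lemma f_diff (H : Dat f L r T a b) : Differentiable ℝ f := H.hf.differentiable (by norm_num)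
lemma g_cont (H : Dat f L r T a b) (s : ℝ) : Continuous (gg f a b s) :=
  (H.hf.continuous.comp (H.u_cont s)).sub (H.hf.continuous.comp (H.u_cont 0))
lemma g_per (s : ℝ) : Function.Periodic (gg f a b s) 1 := by
  intro y
  have h1 := Sr_per (uc a b s) y
  have h2 := Sr_per (uc a b 0) y
  simp only [gg, uu, h1, h2]

lemma sup (H : Dat f L r T a b) {s : ℝ} (hs : |s| ≤ T) (y : ℝ) :
    |Sr (dc a b s) y| ≤ 98 * (1 + T) * |s| ^ r * Real.sqrt (ZZ * QQ r a b) := by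
  have hT : 0 ≤ T := (abs_nonneg s).trans hs
  refine (Sr_bound (H.dS s) y).trans ?_
  refine ((H.dS s).tsum_le_tsum (dc1 H.hr0 H.hr1 a b hs) (H.jE.mul_left _)).trans ?_
  rw [tsum_mul_left]
  have := jE_tsum (EE_nonneg r a b) H.hE
  unfold ZZ QQ
  gcongr

lemma diffS {c : ℤ → ℂ} (hc : Summable fun n => ‖c n‖) (h : ℝ) :
    Summable fun n => ‖c n * (ee n h - ee n (-h))‖ := by
  refine Summable.of_nonneg_of_le (fun _ => norm_nonneg _) (fun n => ?_) (hc.mul_left 2)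
  rw [norm_mul, ee_diff]
  have := Real.abs_sin_le_one (2 * π * |(n:ℝ)| * h)
  nlinarith [norm_nonneg (c n)]

lemma diffJ {c : ℤ → ℂ} (hc : Cj c) (h : ℝ) : Cj fun n => c n * (ee n h - ee n (-h)) := by
  intro n
  simp only [hc n, map_mul, map_sub, ee_conj]

lemma diffSr {c : ℤ → ℂ} (hc : Summable fun n => ‖c n‖) (h y : ℝ) :
    Sr c (y + h) - Sr c (y + -h) = Sr (fun n => c n * (ee n h - ee n (-h))) y := by
  rw [Sr_shift, Sr_shift, Sr_sub]
  · congr 1; ext n; ring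
  · simpa [ee_norm] using hc
  · simpa [ee_norm] using hc

lemma diff_norm (c : ℤ → ℂ) (h : ℝ) (n : ℤ) :
    ‖c n * (ee n h - ee n (-h))‖ = 2 * (|Real.sin (ww n * h)| * ‖c n‖) := by
  rw [norm_mul, ee_diff, ww]; ring

lemma diff_fh {φ : ℝ → ℝ} (hc : Continuous φ) (hp : Function.Periodic φ 1) (h : ℝ) (n : ℤ) :
    ‖fh (fun y => φ (y + h) - φ (y + -h)) n‖ ^ 2 = (2 * |Real.sin (ww n * h)|) ^ 2 * ‖fh φ n‖ ^ 2 := by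
  rw [fh_sub (φ := fun y => φ (y + h)) (ψ := fun y => φ (y + -h)) (by fun_prop) (by fun_prop),
    fh_shift hp, fh_shift hp, ← sub_mul, norm_mul, ee_diff, mul_pow, ww]

lemma ss_eq (H : Dat f L r T a b) (s : ℝ) : |s| ^ (1 + r) = |s| * |s| ^ r := by
  rcases (abs_nonneg s).eq_or_lt with h | h
  · rw [← h, Real.zero_rpow (by linarith [H.hr0]), zero_mul]
  · rw [Real.rpow_add h, Real.rpow_one]

lemma const_aux {L K β X Z Q : ℝ} (α κ σ σr : ℝ) (hK : 1 ≤ K) (hZ : 0 ≤ Z) (hQ : 0 ≤ Q)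
    (hα : α = 196 * K * (σ * σr) ∨ α = 196 * (σ * σr))
    (hκ : κ = L * (98 * K * σr * Real.sqrt (Z * Q))) (hβ : β = 14 * σ ∨ β = 98 * σ)
    (hX : X = σ * σr) :
    2 * (L ^ 2 * α ^ 2 + κ ^ 2 * β ^ 2) * Q ≤ 2 * L ^ 2 * (9604 * K) ^ 2 * (1 + Z) * X ^ 2 * (Q + Q ^ 2) := by
  have hK2 : 1 ≤ K ^ 2 := by nlinarith
  have hα2 : α ^ 2 ≤ (9604 * K) ^ 2 * X ^ 2 := by
    have := sq_nonneg X
    rcases hα with h | h <;> rw [h, ← hX] <;> nlinarith [mul_nonneg (sub_nonneg.mpr hK2) this]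
  have hκ2 : κ ^ 2 * β ^ 2 ≤ L ^ 2 * (9604 * K) ^ 2 * X ^ 2 * (Z * Q) := by
    have hs := Real.sq_sqrt (mul_nonneg hZ hQ)
    have hβ2 : β ^ 2 ≤ (98 * σ) ^ 2 := by
      rcases hβ with h | h <;> rw [h] <;> nlinarith [sq_nonneg σ]
    calc κ ^ 2 * β ^ 2 ≤ κ ^ 2 * (98 * σ) ^ 2 := by gcongr
      _ = L ^ 2 * (9604 * K) ^ 2 * (σ * σr) ^ 2 * (Real.sqrt (Z * Q)) ^ 2 := by rw [hκ]; ring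
      _ = _ := by rw [hs, hX]
  have h1 : L ^ 2 * α ^ 2 ≤ L ^ 2 * ((9604 * K) ^ 2 * X ^ 2) := by gcongr
  have h2 : 2 * (L ^ 2 * α ^ 2 + κ ^ 2 * β ^ 2) * Q ≤
     2 * (L ^ 2 * ((9604 * K) ^ 2 * X ^ 2) + L ^ 2 * (9604 * K) ^ 2 * X ^ 2 * (Z * Q)) * Q := by gcongr
  refine h2.trans ?_
  have h3 : 0 ≤ L ^ 2 * (9604 * K) ^ 2 * X ^ 2 := by positivity
  have h4 : 0 ≤ Z * Q := by positivity
  nlinarith [mul_nonneg h3 h4, mul_nonneg h3 (sq_nonneg Q)]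

lemma core_i (H : Dat f L r T a b) {s : ℝ} (hs : |s| ≤ T) (S : Finset ℤ) :
    ∑ n ∈ S, (2 * |Real.sin (ww n * s)|) ^ 2 * ‖fh (gg f a b s) n‖ ^ 2 ≤
      2 * L ^ 2 * (9604 * (1 + T)) ^ 2 * (1 + ZZ) * (|s| ^ (1 + r)) ^ 2 * (QQ r a b + QQ r a b ^ 2) := by
  have hT : 0 ≤ T := (abs_nonneg s).trans hs
  have hL := H.L0
  simp only [← diff_fh (H.g_cont s) (g_per s)]
  have hgc := H.g_cont s
  refine (lemB (by fun_prop) H.hE (diffS (H.dS s) s) (diffS H.aS s) (diffJ (H.dJ s) s) (diffJ H.ja s)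
    (L := L) (κ := L * (98 * (1 + T) * |s| ^ r * Real.sqrt (ZZ * QQ r a b)))
    (α := 196 * (1 + T) * |s| ^ (1 + r)) (β := 14 * |s|) (fun n => ?_) (fun n => ?_) (fun y => ?_) S).trans ?_
  · rw [diff_norm]
    have := dc3 H.hr0 H.hr1 a b hs n
    linarith
  · rw [diff_norm]
    have := dc5 H.hr0 H.hr1 a b hs s n
    linarith
  · have h := fourpt H.hf H.hf1 H.hf2 (uu a b s (y + s)) (uu a b 0 (y + s)) (uu a b s (y + -s)) (uu a b 0 (y + -s))
    have e1 : gg f a b s (y + s) - gg f a b s (y + -s) = f (uu a b s (y + s)) - f (uu a b 0 (y + s))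
      - f (uu a b s (y + -s)) + f (uu a b 0 (y + -s)) := by unfold gg; ring
    have e2 : uu a b s (y + s) - uu a b 0 (y + s) - uu a b s (y + -s) + uu a b 0 (y + -s)
       = Sr (fun n => dc a b s n * (ee n s - ee n (-s))) y := by
      rw [← diffSr (H.dS s), ← H.u_sub, ← H.u_sub]; ring
    have e3 : uu a b 0 (y + s) - uu a b 0 (y + -s) = Sr (fun n => a n * (ee n s - ee n (-s))) y := by
      rw [← diffSr H.aS, uu, uc_zero]
    rw [e1]
    rw [e2, e3, H.u_sub] at h
    refine h.trans ?_
    have := H.sup hs (y + -s)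
    gcongr
  · rw [H.ss_eq s]
    exact const_aux _ _ |s| (|s| ^ r) (by linarith) ZZ_nonneg (QQ_nonneg r a b) (Or.inl rfl) rfl (Or.inl rfl) rfl

lemma core_ii (H : Dat f L r T a b) {s : ℝ} (hs : |s| ≤ T) (S : Finset ℤ) :
    ∑ n ∈ S, ‖fh (gg f a b s) n‖ ^ 2 ≤ 2 * L ^ 2 * (98 * |s|) ^ 2 * QQ r a b := by
  refine (lemB (H.g_cont s) H.hE (H.dS s) (H.dS s) (H.dJ s) (H.dJ s) (L := L) (κ := 0)
    (dc2 H.hr0 H.hr1 a b hs) (dc2 H.hr0 H.hr1 a b hs) (fun y => ?_) S).trans (le_of_eq ?_)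
  · have := lip H.f_diff H.hf1 (uu a b s y) (uu a b 0 y)
    rw [H.u_sub] at this
    simpa [gg] using this
  · unfold QQ; ring

lemma core_iii (H : Dat f L r T a b) {s : ℝ} (hs : |s| ≤ T) (S : Finset ℤ) :
    ∑ n ∈ S, ‖fh (gg f a b s) n + fh (gg f a b (-s)) n‖ ^ 2 ≤
      2 * L ^ 2 * (9604 * (1 + T)) ^ 2 * (1 + ZZ) * (|s| ^ (1 + r)) ^ 2 * (QQ r a b + QQ r a b ^ 2) := by
  have hT : 0 ≤ T := (abs_nonneg s).trans hs
  have hs' : |-s| ≤ T := by rwa [abs_neg]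
  have hL := H.L0
  simp only [← fh_add (H.g_cont s) (H.g_cont (-s))]
  have hgc := H.g_cont s
  have hgc' := H.g_cont (-s)
  have e0 : ∀ n, dc a b s n - -dc a b (-s) n = 2 * (((Real.cos (ww n * s) - 1 : ℝ) : ℂ) * a n) := by
    intro n; simp only [dc, snc_neg, mul_neg, Real.cos_neg]; push_cast; ring
  have hp1 : Summable fun n => ‖-dc a b (-s) n‖ := by simpa using H.dS (-s)
  have hp : Summable fun n => ‖dc a b s n - -dc a b (-s) n‖ :=
    Summable.of_nonneg_of_le (fun _ => norm_nonneg _) (fun n => norm_sub_le _ _) ((H.dS s).add hp1)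
  have hpj : Cj fun n => dc a b s n - -dc a b (-s) n := by
    intro n
    have h1 := H.dJ s n
    have h2 := H.dJ (-s) n
    simp only [h1, h2, map_sub, map_neg]
  refine (lemB (by fun_prop) H.hE hp (H.dS (-s)) hpj (H.dJ (-s))
    (L := L) (κ := L * (98 * (1 + T) * |s| ^ r * Real.sqrt (ZZ * QQ r a b)))
    (α := 196 * |s| ^ (1 + r)) (β := 98 * |s|) (fun n => ?_) (fun n => ?_) (fun y => ?_) S).trans ?_
  · rw [e0, norm_mul, norm_mul, Complex.norm_real, Real.norm_eq_abs]
    have := dc4 H.hr0 H.hr1 a b hs n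
    simp only [Complex.norm_ofNat]
    linarith
  · have := dc2 H.hr0 H.hr1 a b hs' n
    rwa [abs_neg] at this
  · have h := fourpt H.hf H.hf1 H.hf2 (uu a b s y) (uu a b 0 y) (uu a b 0 y) (uu a b (-s) y)
    have e1 : gg f a b s y + gg f a b (-s) y = f (uu a b s y) - f (uu a b 0 y) - f (uu a b 0 y)
      + f (uu a b (-s) y) := by unfold gg; ring
    have e3 : |uu a b 0 y - uu a b (-s) y| = |Sr (dc a b (-s)) y| := by
      rw [abs_sub_comm, H.u_sub]
    have e4 : Sr (fun n => -dc a b (-s) n) y = - Sr (dc a b (-s)) y := by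
      simp [Sr, tsum_neg]
    have e2 : uu a b s y - uu a b 0 y - uu a b 0 y + uu a b (-s) y
       = Sr (fun n => dc a b s n - -dc a b (-s) n) y := by
      rw [← Sr_sub (H.dS s) hp1, e4, ← H.u_sub, ← H.u_sub]; ring
    rw [e1]
    rw [e2, e3] at h
    refine h.trans ?_
    have := H.sup hs' y
    rw [abs_neg] at this
    gcongr
  · rw [H.ss_eq s]
    exact const_aux _ _ |s| (|s| ^ r) (by linarith) ZZ_nonneg (QQ_nonneg r a b) (Or.inr rfl) rfl (Or.inr rfl) rfl

lemma core_iv (H : Dat f L r T a b) {s : ℝ} (hs : |s| ≤ T) (h : ℝ) (S : Finset ℤ) :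
    ∑ n ∈ S, (2 * |Real.sin (ww n * h)|) ^ 2 * ‖fh (gg f a b s) n‖ ^ 2 ≤
      4 * L ^ 2 * (14 * (1 + T) ^ 2 * |h|) ^ 2 * QQ r a b := by
  have hT : 0 ≤ T := (abs_nonneg s).trans hs
  have hL := H.L0
  simp only [← diff_fh (H.g_cont s) (g_per s)]
  have hgc := H.g_cont s
  refine (lemB (by fun_prop) H.hE (diffS (H.uS s) h) (diffS (H.uS 0) h) (diffJ (H.uJ s) h) (diffJ (H.uJ 0) h)
    (L := L) (κ := L)
    (α := 14 * (1 + T) ^ 2 * |h|) (β := 14 * (1 + T) ^ 2 * |h|) (fun n => ?_) (fun n => ?_) (fun y => ?_) S).trans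
      (le_of_eq ?_)
  · rw [diff_norm]
    have := uc2 H.hr0 H.hr1 a b hs h n
    linarith
  · rw [diff_norm]
    have := uc2 H.hr0 H.hr1 a b (s := 0) (T := T) (by simpa using hT) h n
    linarith
  · have h1 := lip H.f_diff H.hf1 (uu a b s (y + h)) (uu a b s (y + -h))
    have h2 := lip H.f_diff H.hf1 (uu a b 0 (y + h)) (uu a b 0 (y + -h))
    rw [uu, diffSr (H.uS _)] at h1 h2
    have e1 : gg f a b s (y + h) - gg f a b s (y + -h) = (f (Sr (uc a b s) (y + h)) - f (Sr (uc a b s) (y + -h)))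
      - (f (Sr (uc a b 0) (y + h)) - f (Sr (uc a b 0) (y + -h))) := by unfold gg uu; ring
    rw [e1]
    exact (abs_sub _ _).trans (add_le_add h1 h2)
  · unfold QQ; ring

lemma sumM (H : Dat f L r T a b) {s : ℝ} (hs : |s| ≤ T) (S : Finset ℤ) :
    ∑ n ∈ S, ‖fh (gg f a b s) n‖ ≤
      Real.sqrt (ZZ * ((4 * L ^ 2 * (14 * (1 + T) ^ 2) ^ 2 * QQ r a b) + 2 * L ^ 2 * (98 * T) ^ 2 * QQ r a b)) := by
  have hT : 0 ≤ T := (abs_nonneg s).trans hs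
  have h2 := H.core_ii hs S
  have h2' : 2 * L ^ 2 * (98 * |s|) ^ 2 * QQ r a b ≤ 2 * L ^ 2 * (98 * T) ^ 2 * QQ r a b := by
    have := QQ_nonneg r a b
    gcongr
  set N : ℝ := 1 + ∑ n ∈ S, |(n:ℝ)| with hN
  have hN1 : 1 ≤ N := by
    have : 0 ≤ ∑ n ∈ S, |(n:ℝ)| := Finset.sum_nonneg fun _ _ => abs_nonneg _
    linarith
  have h1 := H.core_iv hs (1 / (4 * N)) S
  have hh : 0 < 1 / (4 * N) := by positivity
  have h3 : ∑ n ∈ S, (8 * |(n:ℝ)| * (1 / (4 * N))) ^ 2 * ‖fh (gg f a b s) n‖ ^ 2 ≤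
      4 * L ^ 2 * (14 * (1 + T) ^ 2 * |1 / (4 * N)|) ^ 2 * QQ r a b := by
    refine (Finset.sum_le_sum fun n hn => ?_).trans h1
    have hnN : |(n:ℝ)| ≤ N := by
      have := Finset.single_le_sum (f := fun n : ℤ => |(n:ℝ)|) (fun _ _ => abs_nonneg _) hn
      linarith
    have hx : |ww n * (1 / (4 * N))| = 2 * π * |(n:ℝ)| * (1 / (4 * N)) := by
      rw [abs_mul, abs_of_nonneg (ww_nonneg n), abs_of_pos hh, ww]
    have h4 := Real.mul_abs_le_abs_sin (x := ww n * (1 / (4 * N))) (by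
      rw [hx]
      have : |(n:ℝ)| * (1 / (4 * N)) ≤ 1 / 4 := by
        rw [mul_one_div, div_le_div_iff₀ (by positivity) (by norm_num)]; linarith
      nlinarith [Real.pi_pos])
    rw [hx] at h4
    have e : 2 / π * (2 * π * |(n:ℝ)| * (1 / (4 * N))) = 4 * |(n:ℝ)| * (1 / (4 * N)) := by
      field_simp; ring
    rw [e] at h4
    have : 0 ≤ 8 * |(n:ℝ)| * (1 / (4 * N)) := by positivity
    exact mul_le_mul_of_nonneg_right (pow_le_pow_left₀ this (by linarith) 2) (by positivity)
  rw [abs_of_pos hh] at h3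
  have h5 : ∑ n ∈ S, |(n:ℝ)| ^ 2 * ‖fh (gg f a b s) n‖ ^ 2 ≤ 4 * L ^ 2 * (14 * (1 + T) ^ 2) ^ 2 * QQ r a b := by
    have e1 : ∑ n ∈ S, (8 * |(n:ℝ)| * (1 / (4 * N))) ^ 2 * ‖fh (gg f a b s) n‖ ^ 2 =
       (1 / (4 * N)) ^ 2 * ∑ n ∈ S, 64 * (|(n:ℝ)| ^ 2 * ‖fh (gg f a b s) n‖ ^ 2) := by
      rw [Finset.mul_sum]; refine Finset.sum_congr rfl fun n _ => by ring
    have e2 : 4 * L ^ 2 * (14 * (1 + T) ^ 2 * (1 / (4 * N))) ^ 2 * QQ r a b =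
      (1 / (4 * N)) ^ 2 * (4 * L ^ 2 * (14 * (1 + T) ^ 2) ^ 2 * QQ r a b) := by ring
    rw [e1, e2, mul_le_mul_iff_right₀ (by positivity), ← Finset.mul_sum] at h3
    have : 0 ≤ ∑ n ∈ S, |(n:ℝ)| ^ 2 * ‖fh (gg f a b s) n‖ ^ 2 := Finset.sum_nonneg fun _ _ => by positivity
    linarith
  have h6 : ∑ n ∈ S, (jj n * ‖fh (gg f a b s) n‖) ^ 2 ≤
     4 * L ^ 2 * (14 * (1 + T) ^ 2) ^ 2 * QQ r a b + 2 * L ^ 2 * (98 * T) ^ 2 * QQ r a b := by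
    refine le_trans ?_ (add_le_add h5 (h2.trans h2'))
    rw [← Finset.sum_add_distrib]
    refine Finset.sum_le_sum fun n _ => ?_
    have : jj n ^ 2 ≤ |(n:ℝ)| ^ 2 + 1 := by
      unfold jj
      rcases max_cases |(n:ℝ)| 1 with ⟨h, _⟩ | ⟨h, _⟩ <;> rw [h] <;> nlinarith [sq_nonneg |(n:ℝ)|]
    rw [mul_pow]
    nlinarith [sq_nonneg ‖fh (gg f a b s) n‖]
  apply Real.le_sqrt_of_sq_le
  have e : ∑ n ∈ S, ‖fh (gg f a b s) n‖ = ∑ n ∈ S, (jj n)⁻¹ * (jj n * ‖fh (gg f a b s) n‖) := by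
    refine Finset.sum_congr rfl fun n _ => ?_
    have := (jj_pos n).ne'
    field_simp
  rw [e]
  refine (Finset.sum_mul_sq_le_sq_mul_sq S _ _).trans ?_
  exact mul_le_mul (jj_summable.sum_le_tsum S (fun _ _ => by positivity)) h6
    (Finset.sum_nonneg fun _ _ => by positivity) ZZ_nonneg

lemma u_joint (H : Dat f L r T a b) : Continuous fun p : ℝ × ℝ => uu a b p.1 p.2 := by
  rw [continuous_iff_continuousAt]
  intro p
  have hO : IsOpen {q : ℝ × ℝ | |q.1| < |p.1| + 1} :=
    isOpen_lt (by fun_prop) continuous_const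
  refine ContinuousOn.continuousAt ?_ (hO.mem_nhds (show |p.1| < |p.1| + 1 by linarith))
  unfold uu Sr
  refine Complex.continuous_re.comp_continuousOn ?_
  refine continuousOn_tsum (fun n => Continuous.continuousOn ?_) (H.jE.mul_left ((1 + (|p.1| + 1)) ^ 2)) ?_
  · unfold uc
    have h1 := snc_cont (ww n)
    have h2 := ee_cont n
    fun_prop
  · intro n q hq
    rw [norm_mul, ee_norm, mul_one]
    exact uc1 H.hr0 H.hr1 a b (le_of_lt hq) n

lemma fh_cont (H : Dat f L r T a b) (n : ℤ) : Continuous fun s => fh (gg f a b s) n := by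
  unfold fh
  refine intervalIntegral.continuous_parametric_intervalIntegral_of_continuous' ?_ 0 1
  have h1 := H.u_joint
  have h3 := H.hf.continuous
  have h4 : Continuous fun p : ℝ × ℝ => uu a b 0 p.2 := (H.u_cont 0).comp continuous_snd
  have h5 : Continuous fun p : ℝ × ℝ => ee (-n) p.2 := (ee_cont _).comp continuous_snd
  have : Continuous fun p : ℝ × ℝ => f (uu a b p.1 p.2) - f (uu a b 0 p.2) :=
    (h3.comp h1).sub (h3.comp h4)
  exact (Complex.continuous_ofReal.comp this).mul h5

end Dat

lemma int_cs {φ : ℝ → ℝ} (hφ : Continuous φ) {τ : ℝ} (hτ : 0 < τ) :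
    (∫ s in (-τ)..τ, φ s) ^ 2 ≤ 2 * τ * ∫ s in (-τ)..τ, φ s ^ 2 := by
  set I := ∫ s in (-τ)..τ, φ s with hI
  set m := I / (2 * τ) with hm
  have h0 : 0 ≤ ∫ s in (-τ)..τ, (φ s - m) ^ 2 :=
    intervalIntegral.integral_nonneg (by linarith) (fun s _ => sq_nonneg _)
  have h1 : ∫ s in (-τ)..τ, (φ s - m) ^ 2 =
      (∫ s in (-τ)..τ, φ s ^ 2) - (2 * m) * I + 2 * τ * m ^ 2 := by
    have : ∀ s, (φ s - m) ^ 2 = φ s ^ 2 - (2 * m) * φ s + m ^ 2 := fun s => by ring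
    simp only [this]
    rw [intervalIntegral.integral_add (Continuous.intervalIntegrable (by fun_prop) _ _)
      (Continuous.intervalIntegrable (by fun_prop) _ _),
      intervalIntegral.integral_sub (Continuous.intervalIntegrable (by fun_prop) _ _)
      (Continuous.intervalIntegrable (by fun_prop) _ _), intervalIntegral.integral_const_mul,
      intervalIntegral.integral_const, smul_eq_mul]
    ring
  rw [h1] at h0
  have h2 : I = 2 * τ * m := by rw [hm]; field_simp
  rw [h2] at h0 ⊢
  nlinarith

lemma int_bound {F : ℤ → ℝ → ℂ} (hF : ∀ n, Continuous (F n)) {τ B : ℝ} (hτ : 0 < τ) (S : Finset ℤ)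
    (hB : ∀ s, |s| ≤ τ → ∑ n ∈ S, ‖F n s‖ ^ 2 ≤ B) :
    ∑ n ∈ S, ‖∫ s in (-τ)..τ, F n s‖ ^ 2 ≤ (2 * τ) ^ 2 * B := by
  have h1 : ∀ n ∈ S, ‖∫ s in (-τ)..τ, F n s‖ ^ 2 ≤ 2 * τ * ∫ s in (-τ)..τ, ‖F n s‖ ^ 2 := by
    intro n _
    refine le_trans ?_ (int_cs (hF n).norm hτ)
    exact pow_le_pow_left₀ (norm_nonneg _) (intervalIntegral.norm_integral_le_integral_norm (by linarith)) 2
  refine (Finset.sum_le_sum h1).trans ?_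
  have hi : ∀ n ∈ S, IntervalIntegrable (fun s => ‖F n s‖ ^ 2) volume (-τ) τ :=
    fun n _ => ((hF n).norm.pow 2).intervalIntegrable _ _
  rw [← Finset.mul_sum, ← intervalIntegral.integral_finsetSum hi]
  have h2 : ∫ s in (-τ)..τ, ∑ n ∈ S, ‖F n s‖ ^ 2 ≤ ∫ s in (-τ)..τ, B := by
    refine intervalIntegral.integral_mono_on (by linarith)
      (Continuous.intervalIntegrable (continuous_finsetSum _ fun n _ => (hF n).norm.pow 2) _ _)
      (Continuous.intervalIntegrable (by fun_prop) _ _) (fun s hs => hB s (abs_le.mpr ⟨hs.1, hs.2⟩))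
  rw [intervalIntegral.integral_const, smul_eq_mul] at h2
  nlinarith

lemma glue {F : ℤ → ℝ → ℂ} (hF : ∀ n, Continuous (F n)) {τ M : ℝ} (hτ : 0 < τ)
    (hM : ∀ s, |s| ≤ τ → ∀ S : Finset ℤ, ∑ n ∈ S, ‖F n s‖ ≤ M) :
    (Summable fun n => ‖∫ s in (-τ)..τ, F n s‖) ∧
    ∀ y, ∫ s in (-τ)..τ, Sr (fun n => F n s) y = Sr (fun n => ∫ s in (-τ)..τ, F n s) y := by
  have hle : -τ ≤ τ := by linarith
  have hsI : Summable fun n => ∫ s in (-τ)..τ, ‖F n s‖ := by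
    refine summable_of_sum_le (c := (τ - -τ) * M) (fun n => intervalIntegral.integral_nonneg hle
      (fun s _ => norm_nonneg _)) (fun S => ?_)
    rw [← intervalIntegral.integral_finsetSum
      (fun n _ => Continuous.intervalIntegrable ((hF n).norm) _ _)]
    have h2 : ∫ s in (-τ)..τ, ∑ n ∈ S, ‖F n s‖ ≤ ∫ s in (-τ)..τ, M := by
      refine intervalIntegral.integral_mono_on hle
        (Continuous.intervalIntegrable (continuous_finsetSum _ fun n _ => (hF n).norm) _ _)
        (Continuous.intervalIntegrable (by fun_prop) _ _) (fun s hs => hM s (abs_le.mpr ⟨hs.1, hs.2⟩) S)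
    rwa [intervalIntegral.integral_const, smul_eq_mul] at h2
  have hd : Summable fun n => ‖∫ s in (-τ)..τ, F n s‖ :=
    Summable.of_nonneg_of_le (fun _ => norm_nonneg _)
      (fun n => intervalIntegral.norm_integral_le_integral_norm hle) hsI
  refine ⟨hd, fun y => ?_⟩
  have hc : ∀ n, Continuous fun s => F n s * ee n y := fun n => (hF n).mul continuous_const
  have hcr : ∀ n, Continuous fun s => (F n s * ee n y).re := fun n => Complex.continuous_re.comp (hc n)
  have h1 : ∫ s in (-τ)..τ, Sr (fun n => F n s) y = ∫ s in (-τ)..τ, ∑' n, (F n s * ee n y).re := by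
    refine intervalIntegral.integral_congr (fun s hs => ?_)
    rw [uIcc_of_le hle] at hs
    have : Summable fun n => ‖F n s‖ :=
      summable_of_sum_le (fun _ => norm_nonneg _) (hM s (abs_le.mpr ⟨hs.1, hs.2⟩))
    exact Complex.re_tsum (Sr_sum this y)
  have hItg : ∀ n, IntegrableOn (fun s => (F n s * ee n y).re) (Ioc (-τ) τ) := fun n =>
    (intervalIntegrable_iff_integrableOn_Ioc_of_le hle).mp ((hcr n).intervalIntegrable _ _)
  have h2 : Summable fun n => ∫ s in Ioc (-τ) τ, ‖(F n s * ee n y).re‖ := by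
    refine Summable.of_nonneg_of_le (fun n => integral_nonneg (fun _ => norm_nonneg _)) (fun n => ?_) hsI
    rw [intervalIntegral.integral_of_le hle]
    refine integral_mono (hItg n).norm
      ((intervalIntegrable_iff_integrableOn_Ioc_of_le hle).mp ((hF n).norm.intervalIntegrable _ _)) (fun s => ?_)
    have := Complex.abs_re_le_norm (F n s * ee n y)
    rw [norm_mul, ee_norm, mul_one] at this
    exact this
  have h3 := (hasSum_integral_of_summable_integral_norm hItg h2).tsum_eq
  rw [h1, intervalIntegral.integral_of_le hle, ← h3]
  unfold Sr
  rw [Complex.re_tsum (Sr_sum hd y)]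
  congr 1; ext n
  rw [← intervalIntegral.integral_mul_const, ← intervalIntegral.integral_of_le hle]
  have := (Complex.reCLM).intervalIntegral_comp_comm ((hc n).intervalIntegrable (μ := volume) (-τ) τ)
  simpa using this

/-- coefficients of the two components of the remainder -/
noncomputable def F1 (f : ℝ → ℝ) (a b : ℤ → ℂ) (n : ℤ) (s : ℝ) : ℂ :=
  ((snc (ww n) (-s) : ℝ) : ℂ) * fh (gg f a b s) n
noncomputable def F2 (f : ℝ → ℝ) (a b : ℤ → ℂ) (n : ℤ) (s : ℝ) : ℂ :=
  ((Real.cos (ww n * -s) : ℝ) : ℂ) * fh (gg f a b s) n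

namespace Dat
variable {f : ℝ → ℝ} {L r T : ℝ} {a b : ℤ → ℂ}

noncomputable def CC (L T : ℝ) : ℝ :=
  2 * L ^ 2 * (98 * (1 + T)) ^ 2 + 2 * L ^ 2 * (9604 * (1 + T)) ^ 2 * (1 + ZZ)

lemma F1c (H : Dat f L r T a b) (n : ℤ) : Continuous (F1 f a b n) := by
  have := H.fh_cont n
  have h2 := snc_cont (ww n)
  unfold F1; fun_prop

lemma F2c (H : Dat f L r T a b) (n : ℤ) : Continuous (F2 f a b n) := by
  have := H.fh_cont n
  unfold F2; fun_prop

lemma F1n (n : ℤ) (s : ℝ) : ‖F1 f a b n s‖ = |snc (ww n) s| * ‖fh (gg f a b s) n‖ := by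
  rw [F1, norm_mul, Complex.norm_real, snc_neg, norm_neg, Real.norm_eq_abs]

lemma F2n (n : ℤ) (s : ℝ) : ‖F2 f a b n s‖ = |Real.cos (ww n * s)| * ‖fh (gg f a b s) n‖ := by
  rw [F2, norm_mul, Complex.norm_real, mul_neg, Real.cos_neg, Real.norm_eq_abs]

lemma F1M (H : Dat f L r T a b) : ∃ M, ∀ s, |s| ≤ T → ∀ S : Finset ℤ, ∑ n ∈ S, ‖F1 f a b n s‖ ≤ M := by
  refine ⟨T * Real.sqrt (ZZ * ((4 * L ^ 2 * (14 * (1 + T) ^ 2) ^ 2 * QQ r a b) + 2 * L ^ 2 * (98 * T) ^ 2 * QQ r a b)),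
    fun s hs S => ?_⟩
  · refine le_trans ?_ (mul_le_mul_of_nonneg_left (H.sumM hs S) ((abs_nonneg s).trans hs))
    rw [Finset.mul_sum]
    refine Finset.sum_le_sum fun n _ => ?_
    rw [F1n]
    have := (snc_le n s).trans hs
    gcongr

lemma F2M (H : Dat f L r T a b) : ∃ M, ∀ s, |s| ≤ T → ∀ S : Finset ℤ, ∑ n ∈ S, ‖F2 f a b n s‖ ≤ M := by
  refine ⟨_, fun s hs S => le_trans ?_ (H.sumM hs S)⟩
  refine Finset.sum_le_sum fun n _ => ?_
  rw [F2n]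
  have := Real.abs_cos_le_one (ww n * s)
  nlinarith [norm_nonneg (fh (gg f a b s) n)]

lemma CC_nonneg {L T : ℝ} : 0 ≤ CC L T := by
  have := ZZ_nonneg
  unfold CC; positivity

lemma tau_pow (H : Dat f L r T a b) {τ : ℝ} (hτ : 0 < τ) : τ ^ (2 + r) = τ * τ ^ (1 + r) := by
  rw [show 2 + r = 1 + (1 + r) by ring, Real.rpow_add hτ, Real.rpow_one]

lemma main1 (H : Dat f L r T a b) {τ : ℝ} (hτ : 0 < τ) (hτT : τ ≤ T) (S : Finset ℤ) :
    ∑ n ∈ S, jj n ^ 2 * ‖∫ s in (-τ)..τ, F1 f a b n s‖ ^ 2 ≤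
      4 * CC L T * (τ ^ (2 + r)) ^ 2 * (QQ r a b + QQ r a b ^ 2) := by
  have hQ := QQ_nonneg r a b
  have hZ := ZZ_nonneg
  have h1 : ∀ n, jj n ^ 2 * ‖∫ s in (-τ)..τ, F1 f a b n s‖ ^ 2 =
      ‖∫ s in (-τ)..τ, (jj n : ℂ) * F1 f a b n s‖ ^ 2 := by
    intro n
    rw [intervalIntegral.integral_const_mul, norm_mul, mul_pow, Complex.norm_real, Real.norm_eq_abs, sq_abs]
  simp only [h1]
  refine (int_bound (B := CC L T * (τ ^ (1 + r)) ^ 2 * (QQ r a b + QQ r a b ^ 2))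
    (fun n => continuous_const.mul (H.F1c n)) hτ S ?_).trans (le_of_eq (by rw [H.tau_pow hτ]; ring))
  intro s hs
  have hsT := hs.trans hτT
  have hT : 0 ≤ T := (abs_nonneg s).trans hsT
  have h2 := H.core_i hsT S
  have h3 := H.core_ii hsT S
  have h4 : ∑ n ∈ S, ‖(jj n : ℂ) * F1 f a b n s‖ ^ 2 ≤
      |s| ^ 2 * (∑ n ∈ S, ‖fh (gg f a b s) n‖ ^ 2) +
      ∑ n ∈ S, (2 * |Real.sin (ww n * s)|) ^ 2 * ‖fh (gg f a b s) n‖ ^ 2 := by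
    rw [Finset.mul_sum, ← Finset.sum_add_distrib]
    refine Finset.sum_le_sum fun n _ => ?_
    rw [norm_mul, F1n, Complex.norm_real, Real.norm_eq_abs, abs_of_pos (jj_pos n), ← mul_assoc, mul_pow, ← add_mul]
    refine mul_le_mul_of_nonneg_right ?_ (by positivity)
    by_cases hn : n = 0
    · subst hn
      simp [jj, snc, ww_zero]
    · have hw := ww_ne hn
      have hp : 0 < ww n := lt_of_le_of_ne (ww_nonneg n) (Ne.symm hw)
      have : jj n * |snc (ww n) s| ≤ 2 * |Real.sin (ww n * s)| := by
        simp only [snc, hw, if_false]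
        rw [abs_div, abs_of_pos hp, ← mul_div_assoc, div_le_iff₀ hp]
        nlinarith [jj_le_ww hn, abs_nonneg (Real.sin (ww n * s)), mul_nonneg hp.le (abs_nonneg (Real.sin (ww n * s)))]
      have h5 : (jj n * |snc (ww n) s|) ^ 2 ≤ (2 * |Real.sin (ww n * s)|) ^ 2 :=
        pow_le_pow_left₀ (mul_nonneg (jj_pos n).le (abs_nonneg _)) this 2
      nlinarith [sq_nonneg |s|]
  have h6 : |s| * |s| ≤ (1 + T) * |s| ^ (1 + r) := by
    have := x_le_rpow (abs_nonneg s) hsT H.hr0 H.hr1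
    rw [H.ss_eq s]
    nlinarith [abs_nonneg s]
  have h7 : |s| ^ (1 + r) ≤ τ ^ (1 + r) := Real.rpow_le_rpow (abs_nonneg s) hs (by linarith [H.hr0])
  have h8 : 0 ≤ |s| ^ (1 + r) := by positivity
  have h9 : |s| ^ 2 * (∑ n ∈ S, ‖fh (gg f a b s) n‖ ^ 2) ≤
      2 * L ^ 2 * (98 * (1 + T)) ^ 2 * (τ ^ (1 + r)) ^ 2 * (QQ r a b + QQ r a b ^ 2) := by
    calc _ ≤ |s| ^ 2 * (2 * L ^ 2 * (98 * |s|) ^ 2 * QQ r a b) := by gcongr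
      _ = 2 * L ^ 2 * 98 ^ 2 * (|s| * |s|) ^ 2 * QQ r a b := by ring
      _ ≤ 2 * L ^ 2 * 98 ^ 2 * ((1 + T) * τ ^ (1 + r)) ^ 2 * (QQ r a b + QQ r a b ^ 2) := by
        have h6' : |s| * |s| ≤ (1 + T) * τ ^ (1 + r) :=
          h6.trans (mul_le_mul_of_nonneg_left h7 (by linarith))
        have h6s := pow_le_pow_left₀ (by positivity) h6' 2
        have hQQ : QQ r a b ≤ QQ r a b + QQ r a b ^ 2 := by linarith [sq_nonneg (QQ r a b)]
        exact mul_le_mul (mul_le_mul_of_nonneg_left h6s (by positivity)) hQQ hQ (by positivity)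
      _ = _ := by ring
  refine h4.trans ((add_le_add h9 h2).trans ?_)
  have h10 : 2 * L ^ 2 * (9604 * (1 + T)) ^ 2 * (1 + ZZ) * (|s| ^ (1 + r)) ^ 2 * (QQ r a b + QQ r a b ^ 2) ≤
     2 * L ^ 2 * (9604 * (1 + T)) ^ 2 * (1 + ZZ) * (τ ^ (1 + r)) ^ 2 * (QQ r a b + QQ r a b ^ 2) := by gcongr
  refine (add_le_add le_rfl h10).trans (le_of_eq ?_)
  unfold CC; ring

lemma main2 (H : Dat f L r T a b) {τ : ℝ} (hτ : 0 < τ) (hτT : τ ≤ T) (S : Finset ℤ) :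
    ∑ n ∈ S, ‖∫ s in (-τ)..τ, F2 f a b n s‖ ^ 2 ≤
      4 * CC L T * (τ ^ (2 + r)) ^ 2 * (QQ r a b + QQ r a b ^ 2) := by
  have hQ := QQ_nonneg r a b
  have hZ := ZZ_nonneg
  have h1 : ∀ n, ∫ s in (-τ)..τ, F2 f a b n s = ∫ s in (-τ)..τ, (1 / 2 : ℂ) * (F2 f a b n s + F2 f a b n (-s)) := by
    intro n
    have e := intervalIntegral.integral_comp_neg (a := -τ) (b := τ) (F2 f a b n)
    rw [neg_neg] at e
    have hi2 : IntervalIntegrable (fun s => F2 f a b n (-s)) volume (-τ) τ :=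
      ((H.F2c n).comp continuous_neg).intervalIntegrable _ _
    rw [intervalIntegral.integral_const_mul, intervalIntegral.integral_add
      ((H.F2c n).intervalIntegrable _ _) hi2, e]
    ring
  simp only [h1]
  refine (int_bound (B := CC L T * (τ ^ (1 + r)) ^ 2 * (QQ r a b + QQ r a b ^ 2))
    (fun n => continuous_const.mul ((H.F2c n).add ((H.F2c n).comp continuous_neg))) hτ S ?_).trans
      (le_of_eq (by rw [H.tau_pow hτ]; ring))
  intro s hs
  have hsT := hs.trans hτT
  have hT : 0 ≤ T := (abs_nonneg s).trans hsT
  have h2 := H.core_iii hsT S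
  have h4 : ∑ n ∈ S, ‖(1 / 2 : ℂ) * (F2 f a b n s + F2 f a b n (-s))‖ ^ 2 ≤
      ∑ n ∈ S, ‖fh (gg f a b s) n + fh (gg f a b (-s)) n‖ ^ 2 := by
    refine Finset.sum_le_sum fun n _ => ?_
    have e : F2 f a b n s + F2 f a b n (-s) = ((Real.cos (ww n * s) : ℝ) : ℂ) *
       (fh (gg f a b s) n + fh (gg f a b (-s)) n) := by
      simp only [F2, neg_neg, mul_neg, Real.cos_neg]; ring
    rw [e, norm_mul, norm_mul, Complex.norm_real, Real.norm_eq_abs]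
    refine pow_le_pow_left₀ (by positivity) ?_ 2
    have h3 := Real.abs_cos_le_one (ww n * s)
    have h5 : ‖(1 / 2 : ℂ)‖ = 1 / 2 := by norm_num
    rw [h5]
    have := norm_nonneg (fh (gg f a b s) n + fh (gg f a b (-s)) n)
    nlinarith [mul_le_mul_of_nonneg_right h3 this]
  have h7 : |s| ^ (1 + r) ≤ τ ^ (1 + r) := Real.rpow_le_rpow (abs_nonneg s) hs (by linarith [H.hr0])
  have h10 : 2 * L ^ 2 * (9604 * (1 + T)) ^ 2 * (1 + ZZ) * (|s| ^ (1 + r)) ^ 2 * (QQ r a b + QQ r a b ^ 2) ≤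
     2 * L ^ 2 * (9604 * (1 + T)) ^ 2 * (1 + ZZ) * (τ ^ (1 + r)) ^ 2 * (QQ r a b + QQ r a b ^ 2) := by gcongr
  refine h4.trans (h2.trans (h10.trans ?_))
  unfold CC
  have : 0 ≤ 2 * L ^ 2 * (98 * (1 + T)) ^ 2 * (τ ^ (1 + r)) ^ 2 * (QQ r a b + QQ r a b ^ 2) := by positivity
  nlinarith

lemma F1J (n : ℤ) (s : ℝ) : F1 f a b (-n) s = (starRingEnd ℂ) (F1 f a b n s) := by
  simp only [F1, ww_neg, fh_conj, map_mul, Complex.conj_ofReal]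
lemma F2J (n : ℤ) (s : ℝ) : F2 f a b (-n) s = (starRingEnd ℂ) (F2 f a b n s) := by
  simp only [F2, ww_neg, fh_conj, map_mul, Complex.conj_ofReal]

end Dat

lemma int_Cj {F : ℤ → ℝ → ℂ} (h : ∀ n s, F (-n) s = (starRingEnd ℂ) (F n s)) {τ : ℝ} (hτ : 0 < τ) :
    Cj fun n => ∫ s in (-τ)..τ, F n s := by
  intro n
  simp only [h n]
  rw [intervalIntegral.integral_of_le (by linarith), intervalIntegral.integral_of_le (by linarith),
    ← integral_conj]

lemma glue_fh {F : ℤ → ℝ → ℂ} (hF : ∀ n, Continuous (F n)) {τ M : ℝ} (hτ : 0 < τ)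
    (hM : ∀ s, |s| ≤ τ → ∀ S : Finset ℤ, ∑ n ∈ S, ‖F n s‖ ≤ M)
    (h : ∀ n s, F (-n) s = (starRingEnd ℂ) (F n s)) (n : ℤ) :
    fh (fun y => ∫ s in (-τ)..τ, Sr (fun n => F n s) y) n = ∫ s in (-τ)..τ, F n s := by
  obtain ⟨h1, h2⟩ := glue hF hτ hM
  simp only [h2]
  exact Sr_fh h1 (int_Cj h hτ) n


lemma freq_one (k : Fin 1 → ℤ) : freq k = |((k 0 : ℤ) : ℝ)| := by
  simp [freq, Real.sqrt_sq_eq_abs]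

lemma jb_one (k : Fin 1 → ℤ) : jb k = jj (k 0) := by
  rw [jb, freq_one, jj]

lemma omg_one (k : Fin 1 → ℤ) : omg k = ww (k 0) := by
  rw [omg, freq_one, ww]

lemma tsum_one {E : Type*} [AddCommMonoid E] [TopologicalSpace E] (g : ℤ → E) :
    ∑' k : Fin 1 → ℤ, g (k 0) = ∑' n, g n :=
  (Equiv.funUnique (Fin 1) ℤ).tsum_eq g

lemma summable_one {g : ℤ → ℝ} : (Summable fun k : Fin 1 → ℤ => g (k 0)) ↔ Summable g :=
  (Equiv.funUnique (Fin 1) ℤ).summable_iff (f := g)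

/-- one-dimensional Fourier coefficients -/
noncomputable def cf (u : Fn 1) (n : ℤ) : ℂ := fh (fun y => u fun _ => y) n

lemma cf_Cj (u : Fn 1) : Cj (cf u) := fun n => fh_conj _ n

lemma sob_one (α : ℝ) (u : Fn 1) : sob α u = Real.sqrt (∑' n : ℤ, jj n ^ (2 * α) * ‖cf u n‖ ^ 2) := by
  unfold sob
  simp only [jb_one, fc_eq]
  rw [tsum_one (fun n => jj n ^ (2 * α) * ‖fh (fun y => u fun _ => y) n‖ ^ 2)]
  rfl

lemma mem_one (α : ℝ) (u : Fn 1) : MemSob α u ↔ Summable fun n : ℤ => jj n ^ (2 * α) * ‖cf u n‖ ^ 2 := by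
  unfold MemSob
  simp only [jb_one, fc_eq]
  exact summable_one (g := fun n => jj n ^ (2 * α) * ‖fh (fun y => u fun _ => y) n‖ ^ 2)

lemma expL_fst (s : ℝ) (W : Pair 1) (y : ℝ) :
    (expL s W).1 (fun _ => y) = Sr (uc (cf W.1) (cf W.2) s) y := by
  simp only [expL, omg_one, fc_eq, ch_eq, Sr]
  rw [tsum_one (fun n => (((Real.cos (ww n * s) : ℝ) : ℂ) * fh (fun y => W.1 fun _ => y) n +
    ((snc (ww n) s : ℝ) : ℂ) * fh (fun y => W.2 fun _ => y) n) * ee n y)]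
  rfl

lemma expL_snd (s : ℝ) (W : Pair 1) (y : ℝ) :
    (expL s W).2 (fun _ => y) = Sr (fun n => (((-(ww n) * Real.sin (ww n * s) : ℝ) : ℂ) * cf W.1 n
        + ((Real.cos (ww n * s) : ℝ) : ℂ) * cf W.2 n)) y := by
  simp only [expL, omg_one, fc_eq, ch_eq, Sr]
  rw [tsum_one (fun n => (((-(ww n) * Real.sin (ww n * s) : ℝ) : ℂ) * fh (fun y => W.1 fun _ => y) n
        + ((Real.cos (ww n * s) : ℝ) : ℂ) * fh (fun y => W.2 fun _ => y) n) * ee n y)]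
  rfl

lemma cf_zero (n : ℤ) : cf (fun _ => 0) n = 0 := by simp [cf, fh]

lemma EE_sq (r : ℝ) (a b : ℤ → ℂ) (n : ℤ) : EE r a b n ^ 2 ≤
    2 * (jj n ^ (2 * (1 + r)) * ‖a n‖ ^ 2 + jj n ^ (2 * (1 + r - 1)) * ‖b n‖ ^ 2) := by
  have hj := jj_pos n
  have e1 : jj n ^ (2 * (1 + r)) = (jj n ^ (1 + r)) ^ 2 := by
    rw [← Real.rpow_natCast, ← Real.rpow_mul hj.le]; congr 1; push_cast; ring
  have e2 : jj n ^ (2 * (1 + r - 1)) = (jj n ^ r) ^ 2 := by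
    rw [← Real.rpow_natCast, ← Real.rpow_mul hj.le]; congr 1; push_cast; ring
  rw [e1, e2, EE]
  nlinarith [sq_nonneg (jj n ^ (1 + r) * ‖a n‖ - jj n ^ r * ‖b n‖)]

lemma EE_of_mem {r : ℝ} {W : Pair 1} (h : PMem (1 + r) W) :
    (Summable fun n => EE r (cf W.1) (cf W.2) n ^ 2) ∧
      QQ r (cf W.1) (cf W.2) ≤ 2 * pnorm (1 + r) W ^ 2 := by
  have h1 := (mem_one _ _).mp h.1
  have h2 := (mem_one _ _).mp h.2
  have hs := ((h1.add h2).mul_left 2)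
  have hS : Summable fun n => EE r (cf W.1) (cf W.2) n ^ 2 :=
    Summable.of_nonneg_of_le (fun _ => sq_nonneg _) (fun n => EE_sq r _ _ n) hs
  refine ⟨hS, ?_⟩
  have p1 : 0 ≤ ∑' n : ℤ, jj n ^ (2 * (1 + r)) * ‖cf W.1 n‖ ^ 2 :=
    tsum_nonneg fun n => mul_nonneg (Real.rpow_nonneg (jj_pos n).le _) (sq_nonneg _)
  have p2 : 0 ≤ ∑' n : ℤ, jj n ^ (2 * (1 + r - 1)) * ‖cf W.2 n‖ ^ 2 :=
    tsum_nonneg fun n => mul_nonneg (Real.rpow_nonneg (jj_pos n).le _) (sq_nonneg _)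
  have := hS.tsum_le_tsum (fun n => EE_sq r _ _ n) hs
  rw [tsum_mul_left, h1.tsum_add h2] at this
  unfold pnorm
  rw [Real.sq_sqrt (by positivity), sob_one, sob_one, Real.sq_sqrt p1, Real.sq_sqrt p2]
  exact this

lemma final_arith {P Q N t K : ℝ} (hN : 0 ≤ N) (hQ0 : 0 ≤ Q) (hQ : Q ≤ 2 * N ^ 2) (ht : 0 ≤ t) (hK : 0 ≤ K)
    (hP : P ≤ 2 * (4 * K * t ^ 2 * (Q + Q ^ 2))) :
    Real.sqrt P ≤ (Real.sqrt (32 * K) + 1) * t * (1 + N) ^ 2 := by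
  refine Real.sqrt_le_iff.mpr ⟨by positivity, ?_⟩
  have h1 : Q + Q ^ 2 ≤ 4 * ((1 + N) ^ 2) ^ 2 := by
    have : Q ^ 2 ≤ (2 * N ^ 2) ^ 2 := pow_le_pow_left₀ hQ0 hQ 2
    nlinarith [sq_nonneg N, pow_nonneg hN 3, pow_nonneg hN 4]
  have h2 : 32 * K ≤ (Real.sqrt (32 * K) + 1) ^ 2 := by
    nlinarith [Real.sq_sqrt (show 0 ≤ 32 * K by positivity), Real.sqrt_nonneg (32 * K)]
  calc P ≤ 8 * K * t ^ 2 * (Q + Q ^ 2) := by linarith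
    _ ≤ 8 * K * t ^ 2 * (4 * ((1 + N) ^ 2) ^ 2) := by gcongr
    _ = 32 * K * (t ^ 2 * ((1 + N) ^ 2) ^ 2) := by ring
    _ ≤ (Real.sqrt (32 * K) + 1) ^ 2 * (t ^ 2 * ((1 + N) ^ 2) ^ 2) := by gcongr
    _ = _ := by ring

lemma mild_fst {f : ℝ → ℝ} {T t : ℝ} {U : ℝ → Pair 1} (h : IsMild f T U) (h0 : 0 ≤ t) (hT : t ≤ T) (y : ℝ) :
    (U t).1 (fun _ => y) = uu (cf (U t).1) (cf (U t).2) 0 y := by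
  have h1 := h t 0 h0 le_rfl (by linarith)
  have h2 := congrFun (congrArg Prod.fst h1) (fun _ => y)
  simp only [add_zero, Prod.fst_add, Pi.add_apply] at h2
  rw [h2, expL_fst]
  simp [pInt, uu]

lemma R_coeff {f : ℝ → ℝ} {L r T τ : ℝ} {W : Pair 1} (H : Dat f L r T (cf W.1) (cf W.2)) (hτ : 0 < τ)
    (hτT : τ ≤ T) (hW : ∀ y, W.1 (fun _ => y) = uu (cf W.1) (cf W.2) 0 y) (n : ℤ) :
    cf (pInt (-τ) τ fun s => expL (-s) (Fnl f (expL s W) - Fnl f W)).1 n =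
        ∫ s in (-τ)..τ, F1 f (cf W.1) (cf W.2) n s ∧
    cf (pInt (-τ) τ fun s => expL (-s) (Fnl f (expL s W) - Fnl f W)).2 n =
        ∫ s in (-τ)..τ, F2 f (cf W.1) (cf W.2) n s := by
  have hV1 : ∀ s n, cf (Fnl f (expL s W) - Fnl f W).1 n = 0 := by
    intro s n
    simp [Fnl, cf, fh]
  have hV2 : ∀ s n, cf (Fnl f (expL s W) - Fnl f W).2 n = fh (gg f (cf W.1) (cf W.2) s) n := by
    intro s n
    have e : (fun y : ℝ => (Fnl f (expL s W) - Fnl f W).2 fun _ => y) = gg f (cf W.1) (cf W.2) s := by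
      funext y
      simp only [Fnl, Prod.snd_sub, Pi.sub_apply, gg, expL_fst]
      rw [hW]
      rfl
    rw [cf, e]
  obtain ⟨M1, hM1⟩ := H.F1M
  obtain ⟨M2, hM2⟩ := H.F2M
  constructor
  · rw [← glue_fh H.F1c hτ (fun s hs => hM1 s (hs.trans hτT)) Dat.F1J n]
    unfold cf pInt
    congr 1
    funext y
    simp only [expL_fst]
    congr 1; funext s; congr 1; funext n
    simp only [uc, hV1, hV2, F1, mul_zero, zero_add]
    rfl
  · rw [← glue_fh H.F2c hτ (fun s hs => hM2 s (hs.trans hτT)) Dat.F2J n]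
    unfold cf pInt
    congr 1
    funext y
    simp only [expL_snd]
    congr 1; funext s; congr 1; funext n
    simp only [hV1, hV2, F2, mul_zero, zero_add]
    rfl

/-- **Bound on the remainder `R₂(tₙ)` (3.43).**
Let `0 ≤ r < 1`, let `U` be a mild solution with
`U(tₙ) ∈ H^{1+r}(𝕋) × H^r(𝕋)`, and set
`R₂(tₙ) := ∫_{-τ}^{τ} e^{-sL} [F(e^{sL} U(tₙ)) - F(U(tₙ))] ds`.  Then
`‖R₂(tₙ)‖₁ ≲ τ^{2+r} (1 + ‖U(tₙ)‖_{1+r})²`. -/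
theorem R2_bound
    (f : ℝ → ℝ) (L : ℝ) (hf : ContDiff ℝ 2 f)
    (hf1 : ∀ x : ℝ, |deriv f x| ≤ L) (hf2 : ∀ x : ℝ, |deriv (deriv f) x| ≤ L)
    (T : ℝ) (hT : 0 < T) (r : ℝ) (hr0 : 0 ≤ r) (hr1 : r < 1) :
    ∃ C > 0, ∀ τ : ℝ, 0 < τ → ∀ U : ℝ → Pair 1, IsMild f T U →
      ∀ n : ℕ, 1 ≤ n → ((n : ℝ) + 1) * τ ≤ T →
      PMem (1+r) (U ((n : ℝ) * τ)) →
      pnorm 1 (pInt (-τ) τ fun s =>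
          expL (-s) (Fnl f (expL s (U ((n : ℝ) * τ))) - Fnl f (U ((n : ℝ) * τ))))
        ≤ C * τ ^ (2 + r) * (1 + pnorm (1+r) (U ((n : ℝ) * τ)))^2 := by
  refine ⟨Real.sqrt (32 * Dat.CC L T) + 1, by positivity, ?_⟩
  intro τ hτ U hU n hn hnT hmem
  have hn0 : (0:ℝ) ≤ (n : ℝ) := Nat.cast_nonneg n
  have hτT : τ ≤ T := by nlinarith
  have hW := mild_fst hU (t := (n : ℝ) * τ) (by positivity) (by nlinarith)
  generalize U ((n : ℝ) * τ) = W at hW hmem ⊢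
  obtain ⟨hE, hQ⟩ := EE_of_mem hmem
  have H : Dat f L r T (cf W.1) (cf W.2) :=
    { hf := hf, hf1 := hf1, hf2 := hf2, hr0 := hr0, hr1 := hr1.le, ja := cf_Cj _, jb := cf_Cj _, hE := hE }
  have hc := R_coeff H hτ hτT hW
  set R := pInt (-τ) τ fun s => expL (-s) (Fnl f (expL s W) - Fnl f W) with hR
  have hQ0 := QQ_nonneg r (cf W.1) (cf W.2)
  have hK := Dat.CC_nonneg (L := L) (T := T)
  set B := 4 * Dat.CC L T * (τ ^ (2 + r)) ^ 2 * (QQ r (cf W.1) (cf W.2) + QQ r (cf W.1) (cf W.2) ^ 2) with hB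
  have hB0 : 0 ≤ B := by positivity
  have s1 : sob 1 R.1 ^ 2 ≤ B := by
    rw [sob_one, Real.sq_sqrt (tsum_nonneg fun n => mul_nonneg (Real.rpow_nonneg (jj_pos n).le _) (sq_nonneg _))]
    refine Real.tsum_le_of_sum_le (fun n => mul_nonneg (Real.rpow_nonneg (jj_pos n).le _) (sq_nonneg _)) fun S => ?_
    refine le_trans (le_of_eq ?_) (H.main1 hτ hτT S)
    refine Finset.sum_congr rfl fun n _ => ?_
    rw [(hc n).1, mul_one, Real.rpow_two]
  have s2 : sob (1 - 1) R.2 ^ 2 ≤ B := by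
    rw [sob_one, Real.sq_sqrt (tsum_nonneg fun n => mul_nonneg (Real.rpow_nonneg (jj_pos n).le _) (sq_nonneg _))]
    refine Real.tsum_le_of_sum_le (fun n => mul_nonneg (Real.rpow_nonneg (jj_pos n).le _) (sq_nonneg _)) fun S => ?_
    refine le_trans (le_of_eq ?_) (H.main2 hτ hτT S)
    refine Finset.sum_congr rfl fun n _ => ?_
    rw [(hc n).2, sub_self, mul_zero, Real.rpow_zero, one_mul]
  unfold pnorm
  exact final_arith (Real.sqrt_nonneg _) hQ0 hQ (by positivity) hK (by linarith)

end KG
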